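/- arXiv:1608.05091 — 6 statements merged into one kernel-verified Lean document; each statement's English description precedes it below -/
import Mathlib

section
/- Let X be a compact topological space, R a circular order on X whose interval topology equals the topology of X, and S a monoid acting on X by continuous c-order preserving maps. Then the dynamical system (S,X) is tame: for every continuous function f : X → ℝ, the orbit family {x ↦ f(sx) : s ∈ S} contains no independent sequence. -/
/-- A circular order on a set `X`: a ternary relation satisfying cyclicity,
asymmetry, transitivity and totality. -/
structure CircularOrderRel (X : Type*) where
  rel : X → X → X → Prop
  cyclic : ∀ a b c, rel a b c → rel b c a
  asymm : ∀ a b c, rel a b c → ¬ rel a c b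
  trans : ∀ a b c d, rel a b c → rel a c d → rel a b d
  total : ∀ a b c : X, a ≠ b → b ≠ c → a ≠ c → rel a b c ∨ rel a c b

/-- The interval topology of a ternary (circular order) relation: the topology
generated by the open intervals `(a,b) = {x | [a,x,b]}` for distinct `a, b`. -/
def intervalTopology {X : Type*} (r : X → X → X → Prop) : TopologicalSpace X :=
  TopologicalSpace.generateFrom {s | ∃ a b : X, a ≠ b ∧ s = {x | r a x b}}

/-- The closed interval `[a,c]` of a circular order relation. -/
def closedArc {X : Type*} (r : X → X → X → Prop) (a c : X) : Set X :=
  {a, c} ∪ {x | r a x c}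

/-- A map between circularly ordered sets is c-order preserving (COP). -/
def IsCOP {X Y : Type*} (r : X → X → X → Prop) (r' : Y → Y → Y → Prop)
    (f : X → Y) : Prop :=
  (∀ a b c : X, r a b c → f a ≠ f b → f b ≠ f c → f a ≠ f c → r' (f a) (f b) (f c)) ∧
  (∀ a c : X, f a = f c →
    (∀ x ∈ closedArc r a c, f x = f a) ∨ (∀ x ∈ closedArc r c a, f x = f a))

/-- A sequence of real valued functions is independent. -/
def IsIndepSeq {X : Type*} (f : ℕ → X → ℝ) : Prop :=
  ∃ a b : ℝ, a < b ∧ ∀ P M : Finset ℕ, Disjoint P M →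
    ((⋂ n ∈ P, {x | f n x < a}) ∩ (⋂ n ∈ M, {x | b < f n x})).Nonempty

/-- The standard circular order on `{0, 1, …, n-1}` (integers mod `n`). -/
def cyclicFin {n : ℕ} (i j k : Fin n) : Prop :=
  (i < j ∧ j < k) ∨ (j < k ∧ k < i) ∨ (k < i ∧ i < j)

/-- A tuple `(x 0, …, x (n-1))` is a cycle in a circularly ordered set. -/
def IsCycle {X : Type*} (r : X → X → X → Prop) {n : ℕ} (x : Fin n → X) : Prop :=
  (∀ i j k : Fin n, cyclicFin i j k → x i ≠ x j → x j ≠ x k → x i ≠ x k →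
      r (x i) (x j) (x k)) ∧
  (∀ i k : Fin n, x i = x k →
    (∀ j : Fin n, (j = i ∨ j = k ∨ cyclicFin i j k) → x j = x i) ∨
    (∀ j : Fin n, (j = i ∨ j = k ∨ cyclicFin k j i) → x j = x i))

/-- `f` has cyclic variation at most `v`. -/
def CyclicVariationLe {X : Type*} (r : X → X → X → Prop) (f : X → ℝ) (v : ℝ) : Prop :=
  ∀ (n : ℕ) (x : Fin (n + 1) → X), IsCycle r x →
    ∑ i : Fin (n + 1), |f (x i) - f (x (i + 1))| ≤ v

namespace CircularOrderRel

variable {X : Type*} (R : CircularOrderRel X)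

theorem ne₂₃ {a b c : X} (h : R.rel a b c) : b ≠ c := by
  rintro rfl
  exact R.asymm _ _ _ h h

theorem ne₁₂ {a b c : X} (h : R.rel a b c) : a ≠ b :=
  R.ne₂₃ (R.cyclic _ _ _ (R.cyclic _ _ _ h))

theorem ne₁₃ {a b c : X} (h : R.rel a b c) : a ≠ c :=
  (R.ne₂₃ (R.cyclic _ _ _ h)).symm

/-- The strict linear order obtained by cutting a circular order at `w`, with least element `w`. -/
def CutLT (w x y : X) : Prop := (x = w ∧ y ≠ w) ∨ R.rel w x y

theorem cutLT_irrefl (w x : X) : ¬ R.CutLT w x x := by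
  rintro (⟨h, h'⟩ | h)
  · exact h' h
  · exact R.ne₂₃ h rfl

theorem cutLT_trans {w x y t : X} (h : R.CutLT w x y) (h' : R.CutLT w y t) : R.CutLT w x t := by
  rcases h with ⟨rfl, hy⟩ | h <;> rcases h' with ⟨hy', ht⟩ | h'
  · exact absurd hy' hy
  · exact Or.inl ⟨rfl, (R.ne₁₃ h').symm⟩
  · exact absurd hy'.symm (R.ne₁₃ h)
  · exact Or.inr (R.trans _ _ _ _ h h')

theorem cutLT_total (w : X) {x y : X} (h : x ≠ y) : R.CutLT w x y ∨ R.CutLT w y x := by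
  by_cases hx : x = w
  · exact Or.inl (Or.inl ⟨hx, fun hy => h (hx.trans hy.symm)⟩)
  by_cases hy : y = w
  · exact Or.inr (Or.inl ⟨hy, hx⟩)
  exact (R.total w x y (Ne.symm hx) h (Ne.symm hy)).imp Or.inr Or.inr

theorem cutLT_of_rel {w u c v : X} (huv : R.CutLT w u v) (h : R.rel u c v) :
    R.CutLT w u c ∧ R.CutLT w c v := by
  rcases huv with ⟨rfl, -⟩ | huv
  · exact ⟨Or.inl ⟨rfl, (R.ne₁₂ h).symm⟩, Or.inr h⟩
  · have huvw := R.cyclic _ _ _ huv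
    have hvwu := R.cyclic _ _ _ huvw
    have hvuc := R.cyclic _ _ _ (R.cyclic _ _ _ h)
    exact ⟨Or.inr (R.cyclic _ _ _ (R.cyclic _ _ _ (R.trans _ _ _ _ h huvw))),
      Or.inr (R.cyclic _ _ _ (R.trans _ _ _ _ hvwu hvuc))⟩

/-- If an arc starts in `(a, b)` and avoids `a` and `b`, then it ends in `(a, b)`. -/
theorem rel_of_arc_avoids {a b u v : X} (hu : R.rel a u b) (ha : a ∉ closedArc R.rel u v)
    (hb : b ∉ closedArc R.rel u v) : R.rel a v b := by
  have hva : a ≠ v := by rintro rfl; exact ha (by simp [closedArc])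
  have hvb : v ≠ b := by rintro rfl; exact hb (by simp [closedArc])
  refine (R.total a v b hva hvb (R.ne₁₃ hu)).resolve_right fun h => hb (Or.inr ?_)
  exact R.cyclic _ _ _ (R.cyclic _ _ _ (R.trans _ _ _ _ (R.cyclic _ _ _ h)
    (R.cyclic _ _ _ (R.cyclic _ _ _ hu))))

/-- Every arc starting in `U` and avoiding `C` ends in `U`. -/
def Confines (C : Finset X) (U : Set X) : Prop :=
  ∀ u ∈ U, ∀ v, (∀ c ∈ C, c ∉ closedArc R.rel u v) → v ∈ U

variable {R}

theorem Confines.mono {C D : Finset X} {U : Set X} (h : R.Confines C U) (hCD : C ⊆ D) :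
    R.Confines D U :=
  fun u hu v hv => h u hu v fun c hc => hv c (hCD hc)

theorem exists_confines_sInter {F : Set (Set X)} (hF : F.Finite)
    (h : ∀ U ∈ F, ∃ C, R.Confines C U) : ∃ C, R.Confines C (⋂₀ F) := by
  classical
  choose! C hC using h
  refine ⟨hF.toFinset.biUnion C, fun u hu v hv U hU => ?_⟩
  exact ((hC U hU).mono (Finset.subset_biUnion_of_mem C (hF.mem_toFinset.2 hU))) u (hu U hU) v hv

theorem exists_confines_nhd [tX : TopologicalSpace X] (htop : tX = intervalTopology R.rel)
    {U : Set X} {p : X} (hU : IsOpen U) (hp : p ∈ U) :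
    ∃ V ⊆ U, p ∈ V ∧ IsOpen V ∧ ∃ C, R.Confines C V := by
  classical
  have hbasis := TopologicalSpace.isTopologicalBasis_of_subbasis
    (s := {s | ∃ a b : X, a ≠ b ∧ s = {x | R.rel a x b}}) htop
  obtain ⟨V, hV, hpV, hVU⟩ := hbasis.exists_subset_of_mem_open hp hU
  refine ⟨V, hVU, hpV, hbasis.isOpen hV, ?_⟩
  obtain ⟨F, ⟨hF, hFs⟩, rfl⟩ := hV
  refine exists_confines_sInter hF fun W hW => ?_
  obtain ⟨a, b, -, rfl⟩ := hFs hW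
  exact ⟨{a, b}, fun u hu v hv => R.rel_of_arc_avoids hu (hv a (by simp)) (hv b (by simp))⟩

theorem exists_finset_arc_oscillation_lt [tX : TopologicalSpace X] [CompactSpace X]
    (htop : tX = intervalTopology R.rel) {f : X → ℝ} (hf : Continuous f) {δ : ℝ} (hδ : 0 < δ) :
    ∃ C : Finset X, ∀ u v, (∀ c ∈ C, c ∉ closedArc R.rel u v) → |f u - f v| < δ := by
  classical
  have hnhd : ∀ p, ∃ V : Set X, V ⊆ f ⁻¹' Metric.ball (f p) (δ / 2) ∧ p ∈ V ∧
      IsOpen V ∧ ∃ C, R.Confines C V := fun p =>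
    exists_confines_nhd htop (Metric.isOpen_ball.preimage hf) (Metric.mem_ball_self (half_pos hδ))
  choose V hVf hpV hVo C hC using hnhd
  obtain ⟨t, -, ht⟩ := isCompact_univ.elim_nhds_subcover V
    fun p _ => (hVo p).mem_nhds (hpV p)
  refine ⟨t.biUnion C, fun u v huv => ?_⟩
  obtain ⟨p, hp, hup⟩ := Set.mem_iUnion₂.1 (ht (Set.mem_univ u))
  have hvp := ((hC p).mono (Finset.subset_biUnion_of_mem C hp)) u hup v huv
  have hu := hVf p hup
  have hv := hVf p hvp
  rw [Set.mem_preimage, Metric.mem_ball] at hu hv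
  rw [← Real.dist_eq]
  linarith [dist_triangle_right (f u) (f v) (f p)]

open Classical in
variable (R) in
/-- The position of `y` relative to the points of `C`, in the linear order cut at `w`. -/
noncomputable def cutRank (C : Finset X) (w y : X) : ℕ :=
  (C.filter fun c => c = y ∨ R.CutLT w c y).card + (C.filter fun c => R.CutLT w c y).card

theorem cutRank_le (C : Finset X) (w y : X) : R.cutRank C w y ≤ 2 * C.card := by
  classical
  have h₁ := Finset.card_filter_le C fun c => c = y ∨ R.CutLT w c y
  have h₂ := Finset.card_filter_le C fun c => R.CutLT w c y
  rw [two_mul]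
  unfold cutRank
  convert add_le_add h₁ h₂

theorem cutRank_mono (C : Finset X) {w u v : X} (h : R.CutLT w u v) :
    R.cutRank C w u ≤ R.cutRank C w v := by
  classical
  unfold cutRank
  refine add_le_add (Finset.card_le_card ?_) (Finset.card_le_card ?_)
  · exact Finset.monotone_filter_right C fun c _ hc => Or.inr <| by
      rcases hc with rfl | hc
      exacts [h, R.cutLT_trans hc h]
  · exact Finset.monotone_filter_right C fun c _ hc => R.cutLT_trans hc h

theorem cutRank_lt (C : Finset X) {w u v c : X} (h : R.CutLT w u v) (hc : c ∈ C)
    (hcuv : c ∈ closedArc R.rel u v) : R.cutRank C w u < R.cutRank C w v := by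
  classical
  have hle : ∀ d, d = u ∨ R.CutLT w d u → d = v ∨ R.CutLT w d v := by
    rintro d (rfl | hd)
    exacts [Or.inr h, Or.inr (R.cutLT_trans hd h)]
  have hlt : ∀ d, R.CutLT w d u → R.CutLT w d v := fun d hd => R.cutLT_trans hd h
  have key : (¬ (c = u ∨ R.CutLT w c u) ∧ (c = v ∨ R.CutLT w c v)) ∨
      (¬ R.CutLT w c u ∧ R.CutLT w c v) := by
    rcases hcuv with (rfl | rfl) | hcuv
    · exact Or.inr ⟨R.cutLT_irrefl w c, h⟩
    · refine Or.inl ⟨?_, Or.inl rfl⟩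
      rintro (rfl | h')
      · exact R.cutLT_irrefl _ _ h
      · exact R.cutLT_irrefl _ _ (R.cutLT_trans h h')
    · obtain ⟨huc, hcv⟩ := R.cutLT_of_rel h hcuv
      exact Or.inr ⟨fun h' => R.cutLT_irrefl _ _ (R.cutLT_trans h' huc), hcv⟩
  unfold cutRank
  rcases key with ⟨hn, hy⟩ | ⟨hn, hy⟩
  · refine add_lt_add_of_lt_of_le (Finset.card_lt_card ?_) (Finset.card_le_card ?_)
    · refine (Finset.ssubset_iff_of_subset (Finset.monotone_filter_right C fun d _ => hle d)).2
        ⟨c, ?_, ?_⟩ <;> simp only [Finset.mem_filter]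
      exacts [⟨hc, hy⟩, fun h => hn h.2]
    · exact Finset.monotone_filter_right C fun d _ => hlt d
  · refine add_lt_add_of_le_of_lt (Finset.card_le_card ?_) (Finset.card_lt_card ?_)
    · exact Finset.monotone_filter_right C fun d _ => hle d
    · refine (Finset.ssubset_iff_of_subset (Finset.monotone_filter_right C fun d _ => hlt d)).2
        ⟨c, ?_, ?_⟩ <;> simp only [Finset.mem_filter]
      exacts [⟨hc, hy⟩, fun h => hn h.2]

/-- A c-order preserving map stays monotone after cutting at `z` and at `φ z`, except for
a final segment that it may send back to `φ z`. -/
theorem exists_rank_of_isCOP {φ : X → X} (hφ : IsCOP R.rel R.rel φ) (C : Finset X) (z : X) :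
    ∃ ρ : X → ℕ, (∀ x, ρ x ≤ 2 * C.card + 1) ∧ (∀ x y, R.CutLT z x y → ρ x ≤ ρ y) ∧
      ∀ x y, ρ x = ρ y → φ x = φ y ∨ (∀ c ∈ C, c ∉ closedArc R.rel (φ x) (φ y)) ∨
        ∀ c ∈ C, c ∉ closedArc R.rel (φ y) (φ x) := by
  classical
  let T : X → Prop := fun x => φ x = φ z ∧ ∃ x', R.CutLT z x' x ∧ φ x' ≠ φ z
  have hT : ∀ x y, R.CutLT z x y → T x → φ y = φ z := by
    rintro x y hxy ⟨hx, x', hx', hne⟩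
    have hzx' : R.rel z x' x := hx'.resolve_left fun h => hne (h.1 ▸ rfl)
    have hzy : R.rel z x y := hxy.resolve_left fun h => R.ne₁₃ hzx' h.1.symm
    rcases hφ.2 z x hx.symm with h | h
    · exact absurd (h x' (Or.inr hzx')) hne
    · exact (h y (Or.inr (R.cyclic _ _ _ hzy)))
  have hrank : ∀ x, R.cutRank C (φ z) (φ x) ≤ 2 * C.card := fun x => cutRank_le C _ _
  refine ⟨fun x => if T x then 2 * C.card + 1 else R.cutRank C (φ z) (φ x),
    fun x => ?_, fun x y hxy => ?_, fun x y hxy => ?_⟩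
  · dsimp only
    split_ifs
    exacts [le_rfl, (hrank x).trans (Nat.le_succ _)]
  · dsimp only
    by_cases hy : T y
    · rw [if_pos hy]
      split_ifs
      exacts [le_rfl, (hrank x).trans (Nat.le_succ _)]
    have hx : ¬ T x := by
      intro hx
      obtain ⟨x', hx', hne⟩ := hx.2
      exact hy ⟨hT x y hxy hx, x', R.cutLT_trans hx' hxy, hne⟩
    rw [if_neg hx, if_neg hy]
    by_cases hφxy : φ x = φ y
    · rw [hφxy]
    refine cutRank_mono C ?_
    by_cases hxz : φ x = φ z
    · exact Or.inl ⟨hxz, fun h => hφxy (hxz.trans h.symm)⟩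
    have hyz : φ y ≠ φ z := fun h => hy ⟨h, x, hxy, hxz⟩
    have hzxy : R.rel z x y := hxy.resolve_left fun h => hxz (h.1 ▸ rfl)
    exact Or.inr (hφ.1 z x y hzxy (Ne.symm hxz) hφxy hyz.symm)
  · dsimp only at hxy
    have := hrank x
    have := hrank y
    split_ifs at hxy with hx hy hy
    · exact Or.inl (hx.1.trans hy.1.symm)
    · omega
    · omega
    · refine or_iff_not_imp_left.2 fun hne => ?_
      refine (R.cutLT_total (φ z) hne).imp (fun h c hc hcm => ?_) (fun h c hc hcm => ?_)
      · exact (cutRank_lt C h hc hcm).ne hxy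
      · exact (cutRank_lt C h hc hcm).ne hxy.symm

end CircularOrderRel

theorem exists_mul_lt_two_pow (K : ℕ) : ∃ m : ℕ, m * K + 1 < 2 ^ m := by
  refine ⟨2 * (K + 2), ?_⟩
  have h : K + 2 ≤ 2 ^ (K + 1) := Nat.lt_two_pow_self
  rw [two_mul, pow_add, pow_succ 2 (K + 1)]
  nlinarith [Nat.mul_le_mul h h]

/-- Finitely many step functions, each with at most `K` steps along a common linear order,
cannot separate all patterns. -/
theorem not_isIndepSeq_of_rank {X : Type*} {g : ℕ → X → ℝ} {a b : ℝ} (lt : X → X → Prop)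
    (htotal : ∀ x y, x ≠ y → lt x y ∨ lt y x) {K : ℕ} (ρ : ℕ → X → ℕ)
    (hK : ∀ n x, ρ n x ≤ K) (hmono : ∀ n x y, lt x y → ρ n x ≤ ρ n y)
    (hsep : ∀ n x y, ρ n x = ρ n y → g n x < a → ¬ b < g n y)
    (hind : ∀ P M : Finset ℕ, Disjoint P M →
      ((⋂ n ∈ P, {x | g n x < a}) ∩ (⋂ n ∈ M, {x | b < g n x})).Nonempty) : False := by
  obtain ⟨m, hm⟩ := exists_mul_lt_two_pow K
  have hpt : ∀ P : Finset ℕ, ∃ x, (∀ n ∈ P, g n x < a) ∧ ∀ n ∈ Finset.range m \ P, b < g n x := by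
    intro P
    obtain ⟨x, hx₁, hx₂⟩ := hind P (Finset.range m \ P) Finset.disjoint_sdiff
    exact ⟨x, by simpa using hx₁, by simpa using hx₂⟩
  choose x hlow hhigh using hpt
  have hrank_eq : ∀ y y', ∑ n ∈ Finset.range m, ρ n y = ∑ n ∈ Finset.range m, ρ n y' →
      ∀ n ∈ Finset.range m, ρ n y = ρ n y' := by
    intro y y' h
    by_cases hyy : y = y'
    · simp [hyy]
    rcases htotal y y' hyy with hlt | hlt
    · exact (Finset.sum_eq_sum_iff_of_le fun n _ => hmono n _ _ hlt).1 h
    · exact fun n hn =>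
        ((Finset.sum_eq_sum_iff_of_le fun n _ => hmono n _ _ hlt).1 h.symm n hn).symm
  have hsub : ∀ P ∈ (Finset.range m).powerset, ∀ Q : Finset ℕ,
      ∑ n ∈ Finset.range m, ρ n (x P) = ∑ n ∈ Finset.range m, ρ n (x Q) → P ⊆ Q := by
    intro P hP Q h n hn
    by_contra hnQ
    have hnm := Finset.mem_powerset.1 hP hn
    exact hsep n _ _ (hrank_eq _ _ h n hnm) (hlow P n hn)
      (hhigh Q n (Finset.mem_sdiff.2 ⟨hnm, hnQ⟩))
  have hcard := Finset.card_le_card_of_injOn (s := (Finset.range m).powerset)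
    (t := Finset.range (m * K + 1)) (fun P => ∑ n ∈ Finset.range m, ρ n (x P))
    (fun P _ => by
      have := Finset.sum_le_card_nsmul (Finset.range m) (fun n => ρ n (x P)) K fun n _ => hK n _
      simp only [Finset.card_range, smul_eq_mul] at this
      simpa using Nat.lt_succ_of_le this)
    (fun P hP Q hQ h => (hsub P hP Q h).antisymm (hsub Q hQ P h.symm))
  rw [Finset.card_powerset, Finset.card_range, Finset.card_range] at hcard
  omega

/-- A compact circularly ordered dynamical system is tame:
for every continuous real valued function `f` on `X`, the orbit family
`{x ↦ f (s • x) : s ∈ S}` contains no independent sequence. -/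
theorem circularly_ordered_system_is_tame
    {X S : Type*} [tX : TopologicalSpace X] [CompactSpace X]
    [Monoid S] [MulAction S X]
    (R : CircularOrderRel X)
    (htop : tX = intervalTopology R.rel)
    (hcont : ∀ s : S, Continuous (fun x : X => s • x))
    (hcop : ∀ s : S, IsCOP R.rel R.rel (fun x : X => s • x))
    (f : X → ℝ) (hf : Continuous f) :
    ¬ ∃ s : ℕ → S, IsIndepSeq (fun n x => f (s n • x)) := by
  rintro ⟨s, a, b, hab, hind⟩
  obtain ⟨z, -⟩ := hind ∅ ∅ (Finset.disjoint_empty_left _)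
  obtain ⟨C, hC⟩ := CircularOrderRel.exists_finset_arc_oscillation_lt htop hf (sub_pos.2 hab)
  choose ρ hK hmono hsep using
    fun n => CircularOrderRel.exists_rank_of_isCOP (hcop (s n)) C z
  refine not_isIndepSeq_of_rank (R.CutLT z) (fun x y => R.cutLT_total z) ρ hK hmono
    (fun n x y hxy hx hy => ?_) hind
  rcases hsep n x y hxy with h | h | h
  · rw [h] at hx
    exact lt_asymm hab (hy.trans hx)
  · linarith [(abs_lt.1 (hC _ _ h)).1]
  · linarith [(abs_lt.1 (hC _ _ h)).2]
end

section
/- Let X be a compact metrizable space whose topology is the interval topology of a circular order R, and let σ : X → X be a c-order preserving homeomorphism. Then the cascade (X,σ) is null: for every sequence A = (a_0, a_1, a_2, …) of integers, the topological entropy of (X,σ) along the sequence A equals zero. -/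
/-- The minimal cardinality of a finite subcover of a cover `𝒰`. -/
noncomputable def minSubcoverCard {X : Type*} (𝒰 : Set (Set X)) : ℕ :=
  sInf {n : ℕ | ∃ V : Finset (Set X), ↑V ⊆ 𝒰 ∧ V.card = n ∧
    ⋃₀ (V : Set (Set X)) = Set.univ}

/-- The join `⋁_{i<n} 𝒞 i` of a sequence of covers: all intersections
`⋂_{i<n} U i` with `U i ∈ 𝒞 i`. -/
def joinCovers {X : Type*} (𝒞 : ℕ → Set (Set X)) (n : ℕ) : Set (Set X) :=
  {V | ∃ U : ℕ → Set X, (∀ i < n, U i ∈ 𝒞 i) ∧ V = ⋂ i ∈ Finset.range n, U i}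

/-- The image `σ^{-a}(𝒰)` of a cover, i.e. the preimage of `𝒰` under `σ^a`. -/
def pullCover {X : Type*} [TopologicalSpace X] (σ : X ≃ₜ X) (a : ℤ) (𝒰 : Set (Set X)) : Set (Set X) :=
  (fun U : Set X => (fun x : X => (σ.toEquiv ^ a) x) ⁻¹' U) '' 𝒰

/-- The topological entropy of the cascade generated by `σ` along the
sequence `a : ℕ → ℤ`:
`sup_𝒰 limsup_n (1/n) log N(⋁_{i=0}^{n-1} σ^{-a_i}(𝒰))`,
the supremum being over all finite open covers `𝒰` of `X`. -/
noncomputable def seqTopEntropy {X : Type*} [TopologicalSpace X]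
    (σ : X ≃ₜ X) (a : ℕ → ℤ) : ℝ :=
  ⨆ 𝒰 : {𝒰 : Set (Set X) // 𝒰.Finite ∧ (∀ U ∈ 𝒰, IsOpen U) ∧ ⋃₀ 𝒰 = Set.univ},
    Filter.limsup
      (fun n : ℕ =>
        Real.log (minSubcoverCard (joinCovers (fun i => pullCover σ (a i) 𝒰.1) n)) / n)
      Filter.atTop

namespace CircularOrderRel

open scoped Topology

variable {X : Type*} (R : CircularOrderRel X)

/-- The linear order obtained by cutting a circular order at the point `p`, with `p` as minimum. -/
def cutLT (p a b : X) : Prop := (a = p ∧ b ≠ p) ∨ R.rel p a b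

theorem ne_of_rel {a b c : X} (h : R.rel a b c) : a ≠ b ∧ b ≠ c ∧ a ≠ c := by
  refine ⟨?_, ?_, ?_⟩ <;> rintro rfl
  · exact R.asymm _ _ _ (R.cyclic _ _ _ (R.cyclic _ _ _ h)) (R.cyclic _ _ _ (R.cyclic _ _ _ h))
  · exact R.asymm _ _ _ h h
  · exact R.asymm _ _ _ (R.cyclic _ _ _ h) (R.cyclic _ _ _ h)

theorem cutLT_trans_s2 {p a b c : X} (h₁ : R.cutLT p a b) (h₂ : R.cutLT p b c) :
    R.cutLT p a c := by
  rcases h₁ with ⟨rfl, h⟩ | h₁ <;> rcases h₂ with ⟨rfl, h'⟩ | h₂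
  · exact absurd rfl h
  · exact Or.inl ⟨rfl, (R.ne_of_rel h₂).2.2.symm⟩
  · exact absurd rfl (R.ne_of_rel h₁).2.2
  · exact Or.inr (R.trans _ _ _ _ h₁ h₂)

theorem cutLT_irrefl_s2 (p a : X) : ¬ R.cutLT p a a := by
  rintro (⟨rfl, h⟩ | h)
  · exact h rfl
  · exact (R.ne_of_rel h).2.1 rfl

theorem cutLT_or_cutLT (p : X) {a b : X} (h : a ≠ b) : R.cutLT p a b ∨ R.cutLT p b a := by
  by_cases ha : a = p
  · exact Or.inl (Or.inl ⟨ha, fun hb => h (ha.trans hb.symm)⟩)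
  by_cases hb : b = p
  · exact Or.inr (Or.inl ⟨hb, ha⟩)
  exact (R.total p a b (Ne.symm ha) h (Ne.symm hb)).imp Or.inr Or.inr

theorem rel_of_cutLT {p a b c : X} (h₁ : R.cutLT p a b) (h₂ : R.cutLT p b c) :
    R.rel a b c := by
  rcases h₁ with ⟨rfl, h⟩ | h₁ <;> rcases h₂ with ⟨rfl, h'⟩ | h₂
  · exact absurd rfl h
  · exact h₂
  · exact absurd rfl (R.ne_of_rel h₁).2.2
  · exact R.cyclic _ _ _ (R.cyclic _ _ _
      (R.trans _ _ _ _ (R.cyclic _ _ _ h₂) (R.cyclic _ _ _ (R.cyclic _ _ _ h₁))))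

theorem rel_iff_cutLT (p a b c : X) :
    R.rel a b c ↔ (R.cutLT p a b ∧ R.cutLT p b c) ∨ (R.cutLT p b c ∧ R.cutLT p c a) ∨
      (R.cutLT p c a ∧ R.cutLT p a b) := by
  constructor
  · intro h
    obtain ⟨hab, hbc, hac⟩ := R.ne_of_rel h
    have h₁ := R.asymm _ _ _ h
    have h₂ := R.asymm _ _ _ (R.cyclic _ _ _ h)
    have h₃ := R.asymm _ _ _ (R.cyclic _ _ _ (R.cyclic _ _ _ h))
    have k₁ : ¬ (R.cutLT p a c ∧ R.cutLT p c b) := fun k => h₁ (R.rel_of_cutLT k.1 k.2)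
    have k₂ : ¬ (R.cutLT p b a ∧ R.cutLT p a c) := fun k => h₂ (R.rel_of_cutLT k.1 k.2)
    have k₃ : ¬ (R.cutLT p c b ∧ R.cutLT p b a) := fun k => h₃ (R.rel_of_cutLT k.1 k.2)
    have l₁ := R.cutLT_or_cutLT p hab
    have l₂ := R.cutLT_or_cutLT p hbc
    have l₃ := R.cutLT_or_cutLT p hac
    tauto
  · rintro (⟨h₁, h₂⟩ | ⟨h₁, h₂⟩ | ⟨h₁, h₂⟩)
    · exact R.rel_of_cutLT h₁ h₂
    · exact R.cyclic _ _ _ (R.cyclic _ _ _ (R.rel_of_cutLT h₁ h₂))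
    · exact R.cyclic _ _ _ (R.rel_of_cutLT h₁ h₂)

open Classical in
/-- The numbers of points of `F` strictly below, respectively weakly below, `x` in the linear
order cut at `p`. -/
noncomputable def cutPosition (p : X) (F : Finset X) (x : X) : ℕ × ℕ :=
  ((F.filter fun e => R.cutLT p e x).card, (F.filter fun e => ¬ R.cutLT p x e).card)

theorem cutPosition_mem (p : X) (F : Finset X) (x : X) :
    R.cutPosition p F x ∈ Finset.range (F.card + 1) ×ˢ Finset.range (F.card + 1) := by
  simp only [cutPosition, Finset.mem_product, Finset.mem_range, Nat.lt_succ_iff]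
  classical
  exact ⟨Finset.card_filter_le _ _, Finset.card_filter_le _ _⟩

theorem cutLT_iff_of_cutPosition_eq {p : X} {F : Finset X} {x y : X}
    (h : R.cutPosition p F x = R.cutPosition p F y) {e : X} (he : e ∈ F) :
    (R.cutLT p e x ↔ R.cutLT p e y) ∧ (R.cutLT p x e ↔ R.cutLT p y e) := by
  classical
  by_cases hxy : x = y
  · subst hxy
    exact ⟨Iff.rfl, Iff.rfl⟩
  wlog hlt : R.cutLT p x y generalizing x y
  · have := this h.symm (Ne.symm hxy) ((R.cutLT_or_cutLT p hxy).resolve_left hlt)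
    exact ⟨this.1.symm, this.2.symm⟩
  obtain ⟨h₁, h₂⟩ := Prod.mk.inj h
  have e₁ : (F.filter fun e => R.cutLT p e x) = F.filter fun e => R.cutLT p e y := by
    refine Finset.eq_of_subset_of_card_le (fun z hz => ?_) (by convert h₁.ge)
    rw [Finset.mem_filter] at hz ⊢
    exact ⟨hz.1, R.cutLT_trans_s2 hz.2 hlt⟩
  have e₂ : (F.filter fun e => ¬ R.cutLT p x e) = F.filter fun e => ¬ R.cutLT p y e := by
    refine Finset.eq_of_subset_of_card_le (fun z hz => ?_) (by convert h₂.ge)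
    rw [Finset.mem_filter] at hz ⊢
    exact ⟨hz.1, fun k => hz.2 (R.cutLT_trans_s2 hlt k)⟩
  have m₁ := Finset.ext_iff.1 e₁ e
  have m₂ := Finset.ext_iff.1 e₂ e
  simp only [Finset.mem_filter, he, true_and] at m₁ m₂
  exact ⟨m₁, not_iff_not.1 m₂⟩

theorem rel_iff_of_cutPosition_eq {p : X} {F : Finset X} {x y : X}
    (h : R.cutPosition p F x = R.cutPosition p F y) {a b : X} (ha : a ∈ F) (hb : b ∈ F) :
    R.rel a x b ↔ R.rel a y b := by
  have h₁ := R.cutLT_iff_of_cutPosition_eq h ha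
  have h₂ := R.cutLT_iff_of_cutPosition_eq h hb
  rw [R.rel_iff_cutLT p a x b, R.rel_iff_cutLT p a y b, h₁.1, h₂.2]

theorem rel_map_iff {σ : X → X} (hσ : Function.Injective σ) (hcop : IsCOP R.rel R.rel σ)
    (x y z : X) : R.rel (σ x) (σ y) (σ z) ↔ R.rel x y z := by
  have key : ∀ {x y z : X}, R.rel x y z → R.rel (σ x) (σ y) (σ z) := fun h =>
    have hne := R.ne_of_rel h
    hcop.1 _ _ _ h (hσ.ne hne.1) (hσ.ne hne.2.1) (hσ.ne hne.2.2)
  refine ⟨fun h => ?_, key⟩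
  obtain ⟨h₁, h₂, h₃⟩ := R.ne_of_rel h
  exact (R.total x y z (ne_of_apply_ne σ h₁) (ne_of_apply_ne σ h₂)
    (ne_of_apply_ne σ h₃)).resolve_right fun k => R.asymm _ _ _ h (key k)

theorem rel_zpow_iff {σ : Equiv.Perm X} (hcop : IsCOP R.rel R.rel σ) (n : ℤ) (x y z : X) :
    R.rel ((σ ^ n) x) ((σ ^ n) y) ((σ ^ n) z) ↔ R.rel x y z := by
  have hinv : ∀ x y z, R.rel (σ⁻¹ x) (σ⁻¹ y) (σ⁻¹ z) ↔ R.rel x y z := fun x y z => by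
    simpa using (R.rel_map_iff σ.injective hcop (σ⁻¹ x) (σ⁻¹ y) (σ⁻¹ z)).symm
  induction n generalizing x y z with
  | zero => simp
  | succ n ih =>
    rw [zpow_add_one]
    exact (ih _ _ _).trans (R.rel_map_iff σ.injective hcop x y z)
  | pred n ih =>
    rw [zpow_sub_one]
    exact (ih _ _ _).trans (hinv x y z)

theorem rel_zpow_right_iff {σ : Equiv.Perm X} (hcop : IsCOP R.rel R.rel σ) (n : ℤ) (x y z : X) :
    R.rel x ((σ ^ n) y) z ↔ R.rel ((σ ^ n)⁻¹ x) y ((σ ^ n)⁻¹ z) := by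
  simpa using R.rel_zpow_iff hcop n ((σ ^ n)⁻¹ x) y ((σ ^ n)⁻¹ z)

theorem exists_finset_of_isOpen {U : Set X} (hU : IsOpen[intervalTopology R.rel] U) {x : X}
    (hx : x ∈ U) :
    ∃ F : Finset X, ∀ y, (∀ a ∈ F, ∀ b ∈ F, R.rel a x b → R.rel a y b) → y ∈ U := by
  classical
  change TopologicalSpace.GenerateOpen _ U at hU
  induction hU with
  | basic s hs =>
    obtain ⟨a, b, -, rfl⟩ := hs
    exact ⟨{a, b}, fun y hy => hy a (by simp) b (by simp) hx⟩
  | univ => exact ⟨∅, fun _ _ => trivial⟩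
  | inter s t _ _ ihs iht =>
    obtain ⟨F, hF⟩ := ihs hx.1
    obtain ⟨G, hG⟩ := iht hx.2
    refine ⟨F ∪ G, fun y hy => ⟨hF y fun a ha b hb => ?_, hG y fun a ha b hb => ?_⟩⟩
    · exact hy a (Finset.mem_union_left _ ha) b (Finset.mem_union_left _ hb)
    · exact hy a (Finset.mem_union_right _ ha) b (Finset.mem_union_right _ hb)
  | sUnion S _ ih =>
    obtain ⟨s, hs, hxs⟩ := hx
    obtain ⟨F, hF⟩ := ih s hs hxs
    exact ⟨F, fun y hy => ⟨s, hs, hF y hy⟩⟩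

theorem isOpen_setOf_rel_imp (F : Finset X) (x : X) :
    IsOpen[intervalTopology R.rel] {y | ∀ a ∈ F, ∀ b ∈ F, R.rel a x b → R.rel a y b} := by
  let _ := intervalTopology R.rel
  simp only [Set.ofPred_forall]
  refine isOpen_biInter_finset fun a _ => isOpen_biInter_finset fun b _ =>
    isOpen_iInter_of_finite fun h => ?_
  exact TopologicalSpace.isOpen_generateFrom_of_mem ⟨a, b, (R.ne_of_rel h).2.2, rfl⟩

/-- A finite set of points subordinate to an open cover: points which are not separated by arcs
with endpoints in this set lie in a common member of the cover. -/
theorem exists_finset_of_cover [tX : TopologicalSpace X] [CompactSpace X]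
    (htop : tX = intervalTopology R.rel) {𝒰 : Set (Set X)} (ho : ∀ U ∈ 𝒰, IsOpen U)
    (hc : ⋃₀ 𝒰 = Set.univ) :
    ∃ E : Finset X, ∀ x, ∃ U ∈ 𝒰, ∀ y,
      (∀ a ∈ E, ∀ b ∈ E, (R.rel a x b ↔ R.rel a y b)) → y ∈ U := by
  classical
  subst htop
  let _ := intervalTopology R.rel
  have hloc : ∀ x, ∃ F : Finset X, ∃ U ∈ 𝒰,
      ∀ y, (∀ a ∈ F, ∀ b ∈ F, R.rel a x b → R.rel a y b) → y ∈ U := fun x => by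
    obtain ⟨U, hU, hxU⟩ : x ∈ ⋃₀ 𝒰 := hc ▸ Set.mem_univ x
    obtain ⟨F, hF⟩ := R.exists_finset_of_isOpen (ho U hU) hxU
    exact ⟨F, U, hU, hF⟩
  choose F U hU hF using hloc
  obtain ⟨t, ht⟩ := CompactSpace.elim_nhds_subcover
    (fun x => {y | ∀ a ∈ F x, ∀ b ∈ F x, R.rel a x b → R.rel a y b})
    (fun x => (R.isOpen_setOf_rel_imp (F x) x).mem_nhds fun _ _ _ _ h => h)
  refine ⟨t.biUnion F, fun x => ?_⟩
  have hx : x ∈ (⊤ : Set X) := trivial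
  rw [← ht] at hx
  simp only [Set.mem_iUnion] at hx
  obtain ⟨z, hz, hxz⟩ := hx
  exact ⟨U z, hU z, fun y hy => hF z y fun a ha b hb h =>
    (hy a (Finset.mem_biUnion.2 ⟨z, hz, ha⟩) b (Finset.mem_biUnion.2 ⟨z, hz, hb⟩)).1
      (hxz a ha b hb h)⟩

end CircularOrderRel

theorem minSubcoverCard_le_of_code {X ι : Type*} {𝒰 : Set (Set X)} (T : Finset ι) (c : X → ι)
    (hT : ∀ x, c x ∈ T) (h : ∀ x, ∃ U ∈ 𝒰, ∀ y, c x = c y → y ∈ U) :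
    minSubcoverCard 𝒰 ≤ T.card := by
  classical
  choose W hW hcW using h
  have hfin : (Set.range c).Finite :=
    T.finite_toSet.subset (Set.range_subset_iff.2 hT)
  let g : Set.range c → Set X := fun v => W v.2.choose
  have hg : (Set.range g).Finite := by
    have := hfin.to_subtype
    exact Set.finite_range g
  have hle : hg.toFinset.card ≤ T.card := by
    rw [← Set.ncard_eq_toFinset_card _ hg, ← Set.ncard_coe_finset T]
    calc (Set.range g).ncard ≤ (Set.range c).ncard := by
          have := hfin.to_subtype
          rw [← Set.image_univ]
          refine (Set.ncard_image_le Set.finite_univ).trans ?_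
          rw [Set.ncard_univ, Nat.card_coe_set_eq]
      _ ≤ _ := Set.ncard_le_ncard (Set.range_subset_iff.2 hT) T.finite_toSet
  refine le_trans (Nat.sInf_le ⟨hg.toFinset, ?_, rfl, ?_⟩) hle
  · rw [hg.coe_toFinset]
    rintro _ ⟨v, rfl⟩
    exact hW _
  · rw [hg.coe_toFinset]
    refine Set.eq_univ_of_forall fun x => ⟨g ⟨c x, x, rfl⟩, ⟨_, rfl⟩, ?_⟩
    exact hcW _ x (Exists.choose_spec (⟨x, rfl⟩ : c x ∈ Set.range c))

/-- Joins of pullbacks of an open cover along a sequence of length `n` have subcovers of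
size quadratic in `n`. -/
theorem CircularOrderRel.exists_minSubcoverCard_join_le {X : Type*} [tX : TopologicalSpace X]
    [CompactSpace X] (R : CircularOrderRel X) (htop : tX = intervalTopology R.rel)
    (σ : X ≃ₜ X) (hcop : IsCOP R.rel R.rel σ) (a : ℕ → ℤ) {𝒰 : Set (Set X)}
    (ho : ∀ U ∈ 𝒰, IsOpen U) (hc : ⋃₀ 𝒰 = Set.univ) :
    ∃ K : ℕ, ∀ n, minSubcoverCard (joinCovers (fun i => pullCover σ (a i) 𝒰) n) ≤
      (n * K + 1) ^ 2 := by
  classical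
  obtain ⟨E, hE⟩ := R.exists_finset_of_cover htop ho hc
  refine ⟨E.card, fun n => ?_⟩
  rcases isEmpty_or_nonempty X with hX | ⟨⟨p⟩⟩
  · exact (minSubcoverCard_le_of_code (∅ : Finset X) id isEmptyElim isEmptyElim).trans (by simp)
  let τ : ℕ → Equiv.Perm X := fun i => σ.toEquiv ^ a i
  let F : Finset X := (Finset.range n).biUnion fun i => E.image ⇑(τ i)⁻¹
  have hFcard : F.card ≤ n * E.card :=
    (Finset.card_biUnion_le_card_mul (Finset.range n) _ E.card fun i _ =>
      Finset.card_image_le).trans_eq (by rw [Finset.card_range])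
  have hF : ∀ i < n, ∀ e ∈ E, (τ i)⁻¹ e ∈ F := fun i hi e he =>
    Finset.mem_biUnion.2 ⟨i, Finset.mem_range.2 hi, Finset.mem_image_of_mem _ he⟩
  refine (minSubcoverCard_le_of_code _ _ (R.cutPosition_mem p F) fun x => ?_).trans ?_
  · choose U hU hxU using fun i => hE (τ i x)
    refine ⟨_, ⟨fun i => τ i ⁻¹' U i, fun i _ => ⟨U i, hU i, rfl⟩, rfl⟩, fun y hy => ?_⟩
    simp only [Set.mem_iInter, Finset.mem_range]
    refine fun i hi => hxU i _ fun b hb d hd => ?_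
    rw [R.rel_zpow_right_iff hcop, R.rel_zpow_right_iff hcop]
    exact R.rel_iff_of_cutPosition_eq hy (hF i hi b hb) (hF i hi d hd)
  · rw [Finset.card_product, Finset.card_range, sq]
    gcongr

theorem tendsto_log_div_of_le_sq {N : ℕ → ℕ} {K : ℕ} (hN : ∀ n, N n ≤ (n * K + 1) ^ 2) :
    Filter.Tendsto (fun n : ℕ => Real.log (N n) / n) Filter.atTop (nhds 0) := by
  have hlog : Filter.Tendsto (fun n : ℕ => Real.log n / (n : ℝ)) Filter.atTop (nhds 0) :=
    Real.isLittleO_log_id_atTop.tendsto_div_nhds_zero.comp tendsto_natCast_atTop_atTop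
  have hconst : Filter.Tendsto (fun n : ℕ => Real.log (K + 1) / (n : ℝ)) Filter.atTop (nhds 0) :=
    tendsto_const_nhds.div_atTop tendsto_natCast_atTop_atTop
  have hbound := (hlog.add hconst).const_mul 2
  simp only [add_zero, mul_zero] at hbound
  refine tendsto_of_tendsto_of_tendsto_of_le_of_le' tendsto_const_nhds hbound
    (Filter.Eventually.of_forall fun n => div_nonneg (Real.log_natCast_nonneg _) n.cast_nonneg) ?_
  filter_upwards [Filter.eventually_ge_atTop 1] with n hn
  have hn' : (1 : ℝ) ≤ n := by exact_mod_cast hn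
  have hlogN : Real.log (N n) ≤ 2 * (Real.log n + Real.log (K + 1)) := by
    rcases Nat.eq_zero_or_pos (N n) with h0 | hpos
    · rw [h0, Nat.cast_zero, Real.log_zero]
      have := Real.log_nonneg hn'
      have := Real.log_nonneg (le_add_of_nonneg_left K.cast_nonneg : (1 : ℝ) ≤ K + 1)
      positivity
    · rw [← Real.log_mul (by positivity) (by positivity), ← Nat.cast_ofNat (n := 2),
        ← Real.log_pow]
      refine Real.log_le_log (by exact_mod_cast hpos) ?_
      calc (N n : ℝ) ≤ (n * K + 1) ^ 2 := by exact_mod_cast hN n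
        _ ≤ (n * (K + 1)) ^ 2 := by gcongr; linarith
  calc Real.log (N n) / n ≤ 2 * (Real.log n + Real.log (K + 1)) / n := by gcongr
    _ = 2 * (Real.log n / n + Real.log (K + 1) / n) := by ring

/-- A c-ordered metrizable compact cascade is null: its
topological entropy along every sequence of integers vanishes. -/
theorem circularly_ordered_cascade_is_null
    {X : Type*} [tX : TopologicalSpace X] [CompactSpace X] [TopologicalSpace.MetrizableSpace X]
    (R : CircularOrderRel X)
    (htop : tX = intervalTopology R.rel)
    (σ : X ≃ₜ X) (hcop : IsCOP R.rel R.rel (⇑σ))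
    (a : ℕ → ℤ) :
    seqTopEntropy σ a = 0 := by
  have hzero : ∀ 𝒰 : {𝒰 : Set (Set X) // 𝒰.Finite ∧ (∀ U ∈ 𝒰, IsOpen U) ∧ ⋃₀ 𝒰 = Set.univ},
      Filter.limsup (fun n : ℕ =>
        Real.log (minSubcoverCard (joinCovers (fun i => pullCover σ (a i) 𝒰.1) n)) / n)
        Filter.atTop = 0 := fun 𝒰 => by
    obtain ⟨K, hK⟩ := R.exists_minSubcoverCard_join_le htop σ hcop a 𝒰.2.2.1 𝒰.2.2.2
    exact (tendsto_log_div_of_le_sq hK).limsup_eq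
  simp only [seqTopEntropy, hzero, Real.iSup_const_zero]
end

section
/- Let (X,R) be a circularly ordered set, let r > 0, and let c ≤ d be reals. Then the family BV_r(X,[c,d]) of all functions f : X → [c,d] of cyclic variation at most r contains no independent sequence; in particular, any family of [c,d]-valued functions on X with uniformly bounded cyclic variation is a tame family. -/
/-- Cutting a circular order at a point `p` gives a linear order with least element `p` whose
increasing triples are circularly ordered. -/
theorem CircularOrderRel.exists_linearOrder {X : Type*} (R : CircularOrderRel X) (p : X) :
    ∃ _ : LinearOrder X, ∀ x y z : X, x < y → y < z → R.rel x y z := by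
  have degenerate : ∀ a b, ¬ R.rel a b b := fun a b h => R.asymm _ _ _ h h
  let lt : X → X → Prop := fun x y => (x = p ∧ y ≠ p) ∨ R.rel p x y
  have ne_right : ∀ x y, R.rel p x y → y ≠ p := by
    rintro x y h rfl
    exact degenerate _ _ (R.cyclic _ _ _ h)
  have : IsStrictTotalOrder X lt :=
    { irrefl := by
        rintro x (⟨h, h'⟩ | h)
        · exact h' h
        · exact degenerate _ _ h
      trans := by
        rintro x y z (⟨rfl, hy⟩ | hxy) (⟨rfl, hz⟩ | hyz)
        · exact absurd rfl hy
        · exact Or.inl ⟨rfl, ne_right _ _ hyz⟩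
        · exact absurd rfl (ne_right _ _ hxy)
        · exact Or.inr (R.trans _ _ _ _ hxy hyz)
      trichotomous := by
        intro x y hxy hyx
        by_contra hne
        by_cases hx : x = p
        · exact hxy (Or.inl ⟨hx, fun hy => hne (hx.trans hy.symm)⟩)
        by_cases hy : y = p
        · exact hyx (Or.inl ⟨hy, hx⟩)
        rcases R.total p x y (Ne.symm hx) hne (Ne.symm hy) with h | h
        · exact hxy (Or.inr h)
        · exact hyx (Or.inr h) }
  classical
  refine ⟨linearOrderOfSTO lt, ?_⟩
  rintro x y z (⟨rfl, hy⟩ | hxy) (⟨rfl, hz⟩ | hyz)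
  · exact absurd rfl hy
  · exact hyz
  · exact absurd rfl (ne_right _ _ hxy)
  · exact R.cyclic _ _ _ (R.cyclic _ _ _ (R.trans _ _ _ _ (R.cyclic _ _ _ hyz)
      (R.cyclic _ _ _ (R.cyclic _ _ _ hxy))))

/-- A strictly increasing tuple, for a linear order compatible with the circular order, is a
cycle. -/
theorem CircularOrderRel.isCycle_of_strictMono {X : Type*} [LinearOrder X]
    (R : CircularOrderRel X) (hR : ∀ x y z : X, x < y → y < z → R.rel x y z)
    {n : ℕ} {x : Fin n → X} (hx : StrictMono x) : IsCycle R.rel x := by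
  constructor
  · rintro i j k (⟨h, h'⟩ | ⟨h, h'⟩ | ⟨h, h'⟩) - - -
    · exact hR _ _ _ (hx h) (hx h')
    · exact R.cyclic _ _ _ (R.cyclic _ _ _ (hR _ _ _ (hx h) (hx h')))
    · exact R.cyclic _ _ _ (hR _ _ _ (hx h) (hx h'))
  · intro i k hik
    obtain rfl := hx.injective hik
    left
    rintro j (rfl | rfl | h)
    · rfl
    · rfl
    · unfold cyclicFin at h
      omega

/-- Every nonempty finite set of points can be listed injectively as a cycle. -/
theorem CircularOrderRel.exists_isCycle_of_card {X : Type*} (R : CircularOrderRel X)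
    (T : Finset X) {n : ℕ} (hT : T.card = n + 1) :
    ∃ x : Fin (n + 1) → X, Function.Injective x ∧ (∀ i, x i ∈ T) ∧ IsCycle R.rel x := by
  obtain ⟨p, -⟩ : T.Nonempty := Finset.card_pos.mp (by omega)
  obtain ⟨L, hL⟩ := R.exists_linearOrder p
  exact ⟨T.orderEmbOfFin hT, (T.orderEmbOfFin hT).injective, T.orderEmbOfFin_mem hT,
    R.isCycle_of_strictMono hL (T.orderEmbOfFin hT).strictMono⟩

/-- If `N + 1` functions of cyclic variation at most `r` realize all patterns of values below `a`
and above `b`, then `2 ^ (N + 1) * (b - a) ≤ (N + 1) * r`. -/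
theorem CircularOrderRel.two_pow_mul_le {X : Type*} (R : CircularOrderRel X) {r a b : ℝ}
    {f : ℕ → X → ℝ} (hbv : ∀ n, CyclicVariationLe R.rel (f n) r) (hab : a < b)
    (hf : ∀ P M : Finset ℕ, Disjoint P M →
      ((⋂ n ∈ P, {x | f n x < a}) ∩ (⋂ n ∈ M, {x | b < f n x})).Nonempty) (N : ℕ) :
    2 ^ (N + 1) * (b - a) ≤ ((N + 1 : ℕ) : ℝ) * r := by
  classical
  have pattern : ∀ S : Finset ℕ, ∃ x, (∀ n ∈ S, f n x < a) ∧
      ∀ n ∈ Finset.range (N + 1), n ∉ S → b < f n x := by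
    intro S
    obtain ⟨x, hx, hx'⟩ := hf S (Finset.range (N + 1) \ S) Finset.disjoint_sdiff
    simp only [Set.mem_iInter, Set.mem_ofPred_eq] at hx hx'
    exact ⟨x, hx, fun n hn hS => hx' n (Finset.mem_sdiff.mpr ⟨hn, hS⟩)⟩
  choose y hlow hhigh using pattern
  have separated : ∀ S ∈ (Finset.range (N + 1)).powerset,
      ∀ S' ∈ (Finset.range (N + 1)).powerset, S ≠ S' →
      ∃ n ∈ Finset.range (N + 1), b - a ≤ |f n (y S) - f n (y S')| := by
    intro S hS S' hS' hne
    rw [Finset.mem_powerset] at hS hS'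
    obtain ⟨n, hn⟩ : ∃ n, ¬ (n ∈ S ↔ n ∈ S') := by
      by_contra! h
      exact hne (Finset.ext h)
    by_cases h : n ∈ S
    · have h' : n ∉ S' := fun h' => hn (iff_of_true h h')
      have := hlow S n h
      have := hhigh S' n (hS h) h'
      exact ⟨n, hS h, le_abs.mpr (Or.inr (by linarith))⟩
    · have h' : n ∈ S' := by
        by_contra h'
        exact hn (iff_of_false h h')
      have := hlow S' n h'
      have := hhigh S n (hS' h') h
      exact ⟨n, hS' h', le_abs.mpr (Or.inl (by linarith))⟩
  have hinj : Set.InjOn y (Finset.range (N + 1)).powerset := by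
    intro S hS S' hS' heq
    by_contra hne
    obtain ⟨n, -, hn⟩ := separated S hS S' hS' hne
    rw [heq, sub_self, abs_zero] at hn
    linarith
  obtain ⟨m, hm⟩ : ∃ m, 2 ^ (N + 1) = m + 1 + 1 :=
    ⟨2 ^ (N + 1) - 2, by have := Nat.one_le_two_pow (n := N); rw [pow_succ]; omega⟩
  have hcard : ((Finset.range (N + 1)).powerset.image y).card = m + 1 + 1 := by
    rw [Finset.card_image_of_injOn hinj, Finset.card_powerset, Finset.card_range, hm]
  obtain ⟨x, hxinj, hxmem, hxcycle⟩ := R.exists_isCycle_of_card _ hcard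
  have step : ∀ i, b - a ≤ ∑ n ∈ Finset.range (N + 1), |f n (x i) - f n (x (i + 1))| := by
    intro i
    obtain ⟨S, hS, hSx⟩ := Finset.mem_image.mp (hxmem i)
    obtain ⟨S', hS', hSx'⟩ := Finset.mem_image.mp (hxmem (i + 1))
    have hne : S ≠ S' := by
      rintro rfl
      have := hxinj (hSx.symm.trans hSx')
      simp at this
    obtain ⟨n, hn, hle⟩ := separated S hS S' hS' hne
    rw [hSx, hSx'] at hle
    exact hle.trans (Finset.single_le_sum
      (f := fun n => |f n (x i) - f n (x (i + 1))|) (fun _ _ => abs_nonneg _) hn)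
  calc 2 ^ (N + 1) * (b - a) = ∑ _i : Fin (m + 1 + 1), (b - a) := by
        rw [Finset.sum_const, Finset.card_fin, ← hm, nsmul_eq_mul]
        push_cast
        rfl
    _ ≤ ∑ i, ∑ n ∈ Finset.range (N + 1), |f n (x i) - f n (x (i + 1))| :=
        Finset.sum_le_sum fun i _ => step i
    _ = ∑ n ∈ Finset.range (N + 1), ∑ i, |f n (x i) - f n (x (i + 1))| := Finset.sum_comm
    _ ≤ ∑ _n ∈ Finset.range (N + 1), r := Finset.sum_le_sum fun n _ => hbv n _ x hxcycle
    _ = ((N + 1 : ℕ) : ℝ) * r := by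
        rw [Finset.sum_const, Finset.card_range, nsmul_eq_mul]

/-- For a circularly ordered set `(X,R)`, the family
`BV_r(X,[c,d])` of functions with cyclic variation at most `r` is tame:
it contains no independent sequence. -/
theorem bounded_cyclic_variation_family_is_tame
    {X : Type*} (R : CircularOrderRel X)
    (r : ℝ) (hr : 0 < r) (c d : ℝ) (hcd : c ≤ d)
    (f : ℕ → X → ℝ)
    (hmem : ∀ n : ℕ, ∀ x : X, f n x ∈ Set.Icc c d)
    (hbv : ∀ n : ℕ, CyclicVariationLe R.rel (f n) r) :
    ¬ IsIndepSeq f := by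
  rintro ⟨a, b, hab, hf⟩
  have hlim : Filter.Tendsto (fun n : ℕ => (n : ℝ) ^ 1 / 2 ^ n) Filter.atTop (nhds 0) :=
    tendsto_pow_const_div_const_pow_of_one_lt 1 one_lt_two
  obtain ⟨N, hN⟩ := (((Filter.tendsto_add_atTop_iff_nat 1).mpr hlim).eventually_lt_const
    (div_pos (sub_pos.mpr hab) hr)).exists
  rw [pow_one, div_lt_div_iff₀ (by positivity) hr] at hN
  linarith [R.two_pow_mul_le hbv hab hf N]
end

section
/- Let (X,<) be a linearly ordered set, let r > 0, and let c ≤ d be reals. Then the family BV_r(X,[c,d]) of all functions f : X → [c,d] of variation at most r contains no independent sequence (it is a tame family). In particular, the family of all order-preserving functions X → [c,d] is tame. -/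
/-- `f : X → ℝ` on a linearly ordered set has variation at most `v`:
for every finite chain `x 0 ≤ x 1 ≤ … ≤ x n` the sum of the consecutive
differences is at most `v`. -/
def VariationLe {X : Type*} [LinearOrder X] (f : X → ℝ) (v : ℝ) : Prop :=
  ∀ (n : ℕ) (x : Fin (n + 1) → X), Monotone x →
    ∑ i : Fin n, |f (x i.castSucc) - f (x i.succ)| ≤ v

/-- Along a chain through points realizing all sign patterns of `f 0, …, f (n - 1)`, each step
costs at least `b - a` in the total variation of these `n` functions. -/
lemma two_pow_sub_one_mul_le_of_variationLe {X : Type*} [LinearOrder X] {f : ℕ → X → ℝ}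
    {r a b : ℝ} (hab : a < b) (hf : ∀ n, VariationLe (f n) r)
    (hind : ∀ P M : Finset ℕ, Disjoint P M →
      ((⋂ n ∈ P, {x | f n x < a}) ∩ (⋂ n ∈ M, {x | b < f n x})).Nonempty) (n : ℕ) :
    ((2 : ℝ) ^ n - 1) * (b - a) ≤ n * r := by
  have hpat : ∀ S : Finset ℕ, ∃ x : X, (∀ k ∈ S, f k x < a) ∧
      ∀ k ∈ Finset.range n \ S, b < f k x := by
    intro S
    obtain ⟨x, hx⟩ := hind S (Finset.range n \ S) Finset.disjoint_sdiff
    simp only [Set.mem_inter_iff, Set.mem_iInter, Set.mem_ofPred_eq] at hx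
    exact ⟨x, hx⟩
  choose x hlt hgt using hpat
  have hgap : ∀ S T : Finset ℕ, ∀ k ∈ Finset.range n, k ∈ S → k ∉ T →
      b - a ≤ |f k (x S) - f k (x T)| := by
    intro S T k hk hS hT
    have h₁ := hlt S k hS
    have h₂ := hgt T k (Finset.mem_sdiff.2 ⟨hk, hT⟩)
    rw [abs_sub_comm]
    exact (by linarith : b - a ≤ f k (x T) - f k (x S)).trans (le_abs_self _)
  have hsep : ∀ S ∈ (Finset.range n).powerset, ∀ T ∈ (Finset.range n).powerset, S ≠ T →
      ∃ k ∈ Finset.range n, b - a ≤ |f k (x S) - f k (x T)| := by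
    intro S hS T hT hne
    rw [Finset.mem_powerset] at hS hT
    obtain ⟨k, hk⟩ : ∃ k, ¬(k ∈ S ↔ k ∈ T) := by
      by_contra! h
      exact hne (Finset.ext h)
    by_cases hkS : k ∈ S
    · exact ⟨k, hS hkS, hgap S T k (hS hkS) hkS (by tauto)⟩
    · have hkT : k ∈ T := by tauto
      exact ⟨k, hT hkT, abs_sub_comm (f k (x S)) _ ▸ hgap T S k (hT hkT) hkT hkS⟩
  have hinj : Set.InjOn x ((Finset.range n).powerset : Set (Finset ℕ)) := by
    intro S hS T hT hxe
    by_contra hne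
    obtain ⟨k, -, hk⟩ := hsep S hS T hT hne
    rw [hxe, sub_self, abs_zero] at hk
    linarith
  obtain ⟨m, hm⟩ : ∃ m, 2 ^ n = m + 1 := Nat.exists_eq_succ_of_ne_zero (by positivity)
  have hcard : ((Finset.range n).powerset.image x).card = m + 1 := by
    rw [Finset.card_image_of_injOn hinj, Finset.card_powerset, Finset.card_range, hm]
  let u := ((Finset.range n).powerset.image x).orderEmbOfFin hcard
  have hstep : ∀ i : Fin m,
      b - a ≤ ∑ k ∈ Finset.range n, |f k (u i.castSucc) - f k (u i.succ)| := by
    intro i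
    obtain ⟨S, hS, hSu⟩ := Finset.mem_image.1 (Finset.orderEmbOfFin_mem _ hcard i.castSucc)
    obtain ⟨T, hT, hTu⟩ := Finset.mem_image.1 (Finset.orderEmbOfFin_mem _ hcard i.succ)
    have hne : S ≠ T := by
      rintro rfl
      exact i.castSucc_lt_succ.ne (u.injective (hSu.symm.trans hTu))
    obtain ⟨k, hk, hkle⟩ := hsep S hS T hT hne
    rw [hSu, hTu] at hkle
    exact hkle.trans (Finset.single_le_sum
      (f := fun k => |f k (u i.castSucc) - f k (u i.succ)|) (fun _ _ => abs_nonneg _) hk)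
  have hm' : (2 : ℝ) ^ n - 1 = m := by
    rw [sub_eq_iff_eq_add]
    exact_mod_cast hm
  calc ((2 : ℝ) ^ n - 1) * (b - a) = ∑ _i : Fin m, (b - a) := by
        simp [hm', mul_sub]
    _ ≤ ∑ i : Fin m, ∑ k ∈ Finset.range n, |f k (u i.castSucc) - f k (u i.succ)| :=
        Finset.sum_le_sum fun i _ => hstep i
    _ = ∑ k ∈ Finset.range n, ∑ i : Fin m, |f k (u i.castSucc) - f k (u i.succ)| :=
        Finset.sum_comm
    _ ≤ ∑ _k ∈ Finset.range n, r := Finset.sum_le_sum fun k _ => hf k m u u.monotone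
    _ = n * r := by simp

lemma not_isIndepSeq_of_variationLe {X : Type*} [LinearOrder X] {f : ℕ → X → ℝ} {r : ℝ}
    (hf : ∀ n, VariationLe (f n) r) : ¬ IsIndepSeq f := by
  rintro ⟨a, b, hab, hind⟩
  obtain ⟨k, hk⟩ := exists_nat_gt (2 * r / (b - a))
  have hba : 0 < b - a := sub_pos.2 hab
  rw [div_lt_iff₀ hba] at hk
  have hle := two_pow_sub_one_mul_le_of_variationLe hab hf hind (2 * (k + 1))
  have hpow : (k : ℝ) + 2 ≤ 2 ^ (k + 1) := by
    exact_mod_cast (k + 1).lt_two_pow_self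
  have hsq : ((k : ℝ) + 2) ^ 2 ≤ 2 ^ (2 * (k + 1)) := by
    rw [mul_comm 2, pow_mul]
    gcongr
  have hk₀ : (0 : ℝ) ≤ k := k.cast_nonneg
  push_cast at hle
  have h₁ := mul_le_mul_of_nonneg_right hsq hba.le
  have h₂ : ((k : ℝ) + 1) * (2 * r) < (k + 1) * (k * (b - a)) := by gcongr
  nlinarith [mul_nonneg hk₀ hba.le]

lemma Monotone.variationLe {X : Type*} [LinearOrder X] {f : X → ℝ} {c d : ℝ}
    (hf : Monotone f) (hcd : ∀ x, f x ∈ Set.Icc c d) : VariationLe f (d - c) := by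
  intro n x hx
  have habs : ∀ i : Fin n,
      |f (x i.castSucc) - f (x i.succ)| = f (x i.succ) - f (x i.castSucc) := by
    intro i
    rw [abs_sub_comm, abs_of_nonneg (sub_nonneg.2 (hf (hx i.castSucc_lt_succ.le)))]
  have htel := (Fin.sum_univ_succ fun i => f (x i)).symm.trans
    (Fin.sum_univ_castSucc fun i => f (x i))
  simp only [habs, Finset.sum_sub_distrib]
  linarith [(hcd (x 0)).1, (hcd (x (Fin.last n))).2]

/-- For a linearly ordered set `(X,<)`, the family
`BV_r(X,[c,d])` of functions with variation at most `r` is tame (contains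
no independent sequence); in particular the family of all order preserving
functions `X → [c,d]` is tame. -/
theorem bounded_variation_family_is_tame
    {X : Type*} [LinearOrder X]
    (r : ℝ) (hr : 0 < r) (c d : ℝ) (hcd : c ≤ d) :
    (∀ f : ℕ → X → ℝ, (∀ n : ℕ, ∀ x : X, f n x ∈ Set.Icc c d) →
      (∀ n : ℕ, VariationLe (f n) r) → ¬ IsIndepSeq f) ∧
    (∀ f : ℕ → X → ℝ, (∀ n : ℕ, ∀ x : X, f n x ∈ Set.Icc c d) →
      (∀ n : ℕ, Monotone (f n)) → ¬ IsIndepSeq f) := by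
  exact ⟨fun _ _ hf => not_isIndepSeq_of_variationLe hf,
    fun _ hIcc hf => not_isIndepSeq_of_variationLe fun n => (hf n).variationLe (hIcc n)⟩
end

section
/- Let X be a compact topological space and F ⊆ C(X) a uniformly bounded family of continuous real-valued functions. The following are equivalent: (1) F contains no independent sequence (F is a tame family); (2) F contains no sequence which is an ℓ¹-sequence; (3) every function in the closure of F in ℝ^X with the pointwise (product) topology is a fragmented function (F is a Rosenthal family). -/
/-- A uniformly bounded sequence of functions is an `ℓ¹`-sequence. -/
def IsL1Seq {X : Type*} (f : ℕ → X → ℝ) : Prop :=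
  ∃ a : ℝ, 0 < a ∧ ∀ (n : ℕ) (c : Fin n → ℝ),
    a * ∑ i, |c i| ≤ ⨆ x : X, |∑ i, c i * f i x|

/-- A real valued function on a topological space is fragmented. -/
def IsFragmentedReal {X : Type*} [TopologicalSpace X] (f : X → ℝ) : Prop :=
  ∀ ε : ℝ, 0 < ε → ∀ A : Set X, A.Nonempty → IsClosed A →
    ∃ O : Set X, IsOpen O ∧ (A ∩ O).Nonempty ∧
      ∀ x ∈ A ∩ O, ∀ y ∈ A ∩ O, |f x - f y| < ε


open Filter Topology MeasureTheory

theorem exists_isIndepSeq_of_eventually {X : Type*} {F : Set (X → ℝ)} {U : Filter (X → ℝ)}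
    [U.NeBot] (hF : F ∈ U) {H : Set (Set X)} (hH : ∀ E ∈ H, E.Nonempty) {E₀ : Set X}
    (hE₀ : E₀ ∈ H) {a b : ℝ} (hab : a < b)
    (step : ∀ E ∈ H, ∀ᶠ f in U, E ∩ {x | f x < a} ∈ H ∧ E ∩ {x | b < f x} ∈ H) :
    ∃ f : ℕ → X → ℝ, (∀ n, f n ∈ F) ∧ IsIndepSeq f := by
  have key : ∀ s : {s : Set (Set X) // s.Finite ∧ s ⊆ H}, ∃ f ∈ F, ∀ E ∈ s.1,
      E ∩ {x | f x < a} ∈ H ∧ E ∩ {x | b < f x} ∈ H := by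
    rintro ⟨s, hs, hsH⟩
    have h := (eventually_all_finite hs).2 fun E hE => step E (hsH hE)
    obtain ⟨f, hf, hf'⟩ := (Filter.Eventually.and hF h).exists
    exact ⟨f, hf, hf'⟩
  choose g hgF hg using key
  let next : {s : Set (Set X) // s.Finite ∧ s ⊆ H} → {s : Set (Set X) // s.Finite ∧ s ⊆ H} :=
    fun s => ⟨(fun E => E ∩ {x | g s x < a}) '' s.1 ∪ (fun E => E ∩ {x | b < g s x}) '' s.1,
      (s.2.1.image _).union (s.2.1.image _), by
        rintro _ (⟨E, hE, rfl⟩ | ⟨E, hE, rfl⟩)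
        · exact (hg s E hE).1
        · exact (hg s E hE).2⟩
  let S : ℕ → {s : Set (Set X) // s.Finite ∧ s ⊆ H} := fun n =>
    next^[n] ⟨{E₀}, Set.finite_singleton _, by simpa using hE₀⟩
  have hS : ∀ n, S (n + 1) = next (S n) := fun n => Function.iterate_succ_apply' _ _ _
  refine ⟨fun n => g (S n), fun n => hgF _, a, b, hab, fun P M hPM => ?_⟩
  have claim : ∀ n, ∃ E ∈ (S n).1, ∀ x ∈ E, ∀ m < n,
      (m ∈ P → g (S m) x < a) ∧ (m ∈ M → b < g (S m) x) := by
    intro n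
    induction n with
    | zero => exact ⟨E₀, rfl, by simp⟩
    | succ n ih =>
      obtain ⟨E, hE, hx⟩ := ih
      rw [hS]
      by_cases hn : n ∈ P
      · refine ⟨_, Or.inl ⟨E, hE, rfl⟩, fun x hxE m hm => ?_⟩
        rcases Nat.lt_succ_iff_lt_or_eq.1 hm with h | rfl
        · exact hx x hxE.1 m h
        · exact ⟨fun _ => hxE.2, fun h => (Finset.disjoint_left.1 hPM hn h).elim⟩
      · refine ⟨_, Or.inr ⟨E, hE, rfl⟩, fun x hxE m hm => ?_⟩
        rcases Nat.lt_succ_iff_lt_or_eq.1 hm with h | rfl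
        · exact hx x hxE.1 m h
        · exact ⟨fun h => (hn h).elim, fun _ => hxE.2⟩
  obtain ⟨N, hN⟩ := (P ∪ M).bddAbove
  obtain ⟨E, hE, hx⟩ := claim (N + 1)
  obtain ⟨x, hxE⟩ := hH E ((S (N + 1)).2.2 hE)
  refine ⟨x, Set.mem_iInter₂.2 fun n hn => ?_, Set.mem_iInter₂.2 fun n hn => ?_⟩
  · exact (hx x hxE n (Nat.lt_succ_of_le (hN (by simp [hn])))).1 hn
  · exact (hx x hxE n (Nat.lt_succ_of_le (hN (by simp [hn])))).2 hn

/-- A bounded family of functions either contains an independent sequence, or every large set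
contains a large set on which, along the ultrafilter, the functions have small oscillation. Here
being large means belonging to an upward closed family `G` of nonempty sets. -/
theorem exists_subset_small_oscillation {X : Type*} {F : Set (X → ℝ)} {U : Ultrafilter (X → ℝ)}
    (hF : F ∈ U) {C : ℝ} (hC : ∀ f ∈ F, ∀ x, |f x| ≤ C)
    (hind : ¬ ∃ f : ℕ → X → ℝ, (∀ n, f n ∈ F) ∧ IsIndepSeq f)
    {G : Set (Set X)} (hG : ∀ E ∈ G, E.Nonempty) (hmono : ∀ E ∈ G, ∀ E', E ⊆ E' → E' ∈ G)
    {E : Set X} (hE : E ∈ G) {δ : ℝ} (hδ : 0 < δ) :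
    ∃ E' ∈ G, E' ⊆ E ∧ ∃ p q : ℝ, q - p < δ ∧
      ∀ᶠ f in (U : Filter (X → ℝ)), E' ∩ {x | f x < p} ∉ G ∧ E' ∩ {x | q < f x} ∉ G := by
  have hG0 : ∅ ∉ G := fun h => Set.not_nonempty_empty (hG _ h)
  have bisect : ∀ k : ℕ, ∃ E' ∈ G, E' ⊆ E ∧ ∃ p q : ℝ, q - p = 2 * (|C| + 1) * (2 / 3) ^ k ∧
      ∀ᶠ f in (U : Filter (X → ℝ)), E' ∩ {x | f x < p} ∉ G ∧ E' ∩ {x | q < f x} ∉ G := by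
    intro k
    induction k with
    | zero =>
      refine ⟨E, hE, subset_rfl, -(|C| + 1), |C| + 1, by ring, ?_⟩
      filter_upwards [hF] with f hf
      have hb : ∀ x, |f x| ≤ |C| := fun x => (hC f hf x).trans (le_abs_self C)
      have h1 : {x | f x < -(|C| + 1)} = ∅ := by
        ext x
        simp only [Set.mem_ofPred_eq, Set.mem_empty_iff_false, iff_false, not_lt]
        linarith [(abs_le.1 (hb x)).1]
      have h2 : {x | |C| + 1 < f x} = ∅ := by
        ext x
        simp only [Set.mem_ofPred_eq, Set.mem_empty_iff_false, iff_false, not_lt]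
        linarith [(abs_le.1 (hb x)).2]
      rw [h1, h2, Set.inter_empty]
      exact ⟨hG0, hG0⟩
    | succ k ih =>
      obtain ⟨E₁, hE₁, hE₁E, p, q, hpq, hev⟩ := ih
      have hpos : 0 < q - p := by rw [hpq]; positivity
      have hab : p + (q - p) / 3 < p + 2 * (q - p) / 3 := by linarith
      obtain ⟨E₂, hE₂, hE₂E, hE₂'⟩ : ∃ E₂ ∈ G, E₂ ⊆ E₁ ∧
          ¬ ∀ᶠ f in (U : Filter (X → ℝ)), E₂ ∩ {x | f x < p + (q - p) / 3} ∈ G ∧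
            E₂ ∩ {x | p + 2 * (q - p) / 3 < f x} ∈ G := by
        by_contra! hcon
        refine hind (exists_isIndepSeq_of_eventually (U := (U : Filter (X → ℝ))) hF
          (H := {S | S ∈ G ∧ S ⊆ E₁}) (fun S hS => hG S hS.1) ⟨hE₁, subset_rfl⟩ hab ?_)
        rintro S ⟨hS, hSE⟩
        filter_upwards [hcon S hS hSE] with f hf
        exact ⟨⟨hf.1, Set.inter_subset_left.trans hSE⟩, ⟨hf.2, Set.inter_subset_left.trans hSE⟩⟩
      rw [← Ultrafilter.eventually_not] at hE₂'
      have hor : (∀ᶠ f in (U : Filter (X → ℝ)), E₂ ∩ {x | f x < p + (q - p) / 3} ∉ G) ∨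
          ∀ᶠ f in (U : Filter (X → ℝ)), E₂ ∩ {x | p + 2 * (q - p) / 3 < f x} ∉ G := by
        rw [← Ultrafilter.eventually_or]
        filter_upwards [hE₂'] with f hf using not_and_or.1 hf
      rcases hor with h | h
      · refine ⟨E₂, hE₂, hE₂E.trans hE₁E, p + (q - p) / 3, q, ?_, ?_⟩
        · rw [pow_succ]; linarith
        · filter_upwards [h, hev] with f h1 h2
          exact ⟨h1, fun h3 => h2.2 (hmono _ h3 _ (Set.inter_subset_inter_left _ hE₂E))⟩
      · refine ⟨E₂, hE₂, hE₂E.trans hE₁E, p, p + 2 * (q - p) / 3, ?_, ?_⟩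
        · rw [pow_succ]; linarith
        · filter_upwards [h, hev] with f h1 h2
          exact ⟨fun h3 => h2.1 (hmono _ h3 _ (Set.inter_subset_inter_left _ hE₂E)), h1⟩
  have hlim : Tendsto (fun k : ℕ => 2 * (|C| + 1) * (2 / 3 : ℝ) ^ k) atTop (𝓝 0) := by
    simpa using (tendsto_pow_atTop_nhds_zero_of_lt_one (by norm_num : (0 : ℝ) ≤ 2 / 3)
      (by norm_num)).const_mul (2 * (|C| + 1))
  obtain ⟨k, hk⟩ := (hlim.eventually_lt_const hδ).exists
  obtain ⟨E', hE', hE'E, p, q, hpq, hev⟩ := bisect k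
  exact ⟨E', hE', hE'E, p, q, hpq ▸ hk, hev⟩

theorem isFragmentedReal_of_mem_closure {X : Type*} [TopologicalSpace X] {F : Set (X → ℝ)}
    {C : ℝ} (hC : ∀ f ∈ F, ∀ x, |f x| ≤ C) (hcont : ∀ f ∈ F, Continuous f)
    (hind : ¬ ∃ f : ℕ → X → ℝ, (∀ n, f n ∈ F) ∧ IsIndepSeq f) {g : X → ℝ} (hg : g ∈ closure F) :
    IsFragmentedReal g := by
  intro ε hε A hA _
  obtain ⟨U, hFU, hUg⟩ := mem_closure_iff_ultrafilter.1 hg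
  obtain ⟨E', ⟨V, hVo, hVE, hVA⟩, -, p, q, hpq, hev⟩ :=
    exists_subset_small_oscillation hFU hC hind
      (G := {E | ∃ V, IsOpen V ∧ V ⊆ E ∧ (A ∩ V).Nonempty})
      (fun E ⟨V, _, hVE, hV⟩ => (hV.mono Set.inter_subset_right).mono hVE)
      (fun E ⟨V, hVo, hVE, hV⟩ E' hE => ⟨V, hVo, hVE.trans hE, hV⟩)
      (E := Set.univ) ⟨Set.univ, isOpen_univ, subset_rfl, by simpa using hA⟩ hε
  have hlim : ∀ x, Tendsto (fun f : X → ℝ => f x) U (𝓝 (g x)) := fun x =>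
    ((continuous_apply x).tendsto g).mono_left hUg
  have hbd : ∀ x ∈ A ∩ V, p ≤ g x ∧ g x ≤ q := by
    rintro x ⟨hxA, hxV⟩
    constructor
    · by_contra! hlt
      obtain ⟨f, hf, hfF, hfx⟩ := (hev.and (Filter.Eventually.and hFU
        ((hlim x).eventually_lt_const hlt))).exists
      exact hf.1 ⟨V ∩ {x | f x < p}, hVo.inter (isOpen_lt (hcont f hfF) continuous_const),
        Set.inter_subset_inter_left _ hVE, x, hxA, hxV, hfx⟩
    · by_contra! hlt
      obtain ⟨f, hf, hfF, hfx⟩ := (hev.and (Filter.Eventually.and hFU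
        ((hlim x).eventually_const_lt hlt))).exists
      exact hf.2 ⟨V ∩ {x | q < f x}, hVo.inter (isOpen_lt continuous_const (hcont f hfF)),
        Set.inter_subset_inter_left _ hVE, x, hxA, hxV, hfx⟩
  refine ⟨V, hVo, hVA, fun x hx y hy => abs_lt.2 ?_⟩
  have := hbd x hx
  have := hbd y hy
  constructor <;> linarith

/-- A version of `exists_compact_surjective_zorn_subset` with a weaker universe restriction. -/
theorem exists_isCompact_minimal_surjective.{u} {D : Type u} {A : Type} [TopologicalSpace D]
    [TopologicalSpace A] [T1Space A] [CompactSpace D] {φ : D → A} (hφ : Continuous φ)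
    (hsurj : φ.Surjective) : ∃ E : Set D, CompactSpace E ∧ φ '' E = Set.univ ∧
      ∀ E₀ : Set E, E₀ ≠ Set.univ → IsClosed E₀ → E.domRestrict φ '' E₀ ≠ Set.univ := by
  obtain ⟨E, hE, hEs, hEmin⟩ := exists_compact_surjective_zorn_subset (A := ULift.{u} A)
    (continuous_uliftUp.comp hφ) (ULift.up_surjective.comp hsurj)
  refine ⟨E, hE, Set.eq_univ_of_forall fun a => ?_, fun E₀ hne hcl h =>
    hEmin E₀ hne hcl (Set.eq_univ_of_forall fun a => ?_)⟩
  · obtain ⟨e, he, hea⟩ : ULift.up a ∈ (ULift.up ∘ φ) '' E := hEs ▸ Set.mem_univ _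
    exact ⟨e, he, ULift.up_injective hea⟩
  · obtain ⟨e, he, hea⟩ : a.down ∈ E.domRestrict φ '' E₀ := h ▸ Set.mem_univ _
    exact ⟨e, he, congrArg ULift.up hea⟩

theorem exists_mem_closure_not_isFragmentedReal {X : Type*} [TopologicalSpace X] [CompactSpace X]
    {F : Set (X → ℝ)} {C : ℝ} (hC : ∀ f ∈ F, ∀ x, |f x| ≤ C) (hcont : ∀ f ∈ F, Continuous f)
    {f : ℕ → X → ℝ} (hf : ∀ n, f n ∈ F) (hind : IsIndepSeq f) :
    ∃ g ∈ closure F, ¬ IsFragmentedReal g := by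
  classical
  obtain ⟨a, b, hab, hind⟩ := hind
  obtain ⟨g, -, hg⟩ := (isCompact_univ_pi (fun _ : X => isCompact_Icc (a := -C) (b := C)))
    |>.ultrafilter_le_nhds ((hyperfilter ℕ).map f) (by
      refine le_principal_iff.2 (Ultrafilter.mem_map.2 (Filter.univ_mem' fun n x _ => ?_))
      exact abs_le.1 (hC _ (hf n) x))
  have hlim : ∀ x, Tendsto (fun n => f n x) (hyperfilter ℕ) (𝓝 (g x)) := fun x =>
    ((continuous_apply x).tendsto g).comp hg
  refine ⟨g, mem_closure_of_tendsto (f := f) (b := (hyperfilter ℕ : Filter ℕ)) hg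
    (Filter.Eventually.of_forall hf), fun hfrag => ?_⟩
  let K : Set X := {x | ∀ n, f n x ≤ a ∨ b ≤ f n x}
  have hK : IsClosed K := by
    have : K = ⋂ n, ({x | f n x ≤ a} ∪ {x | b ≤ f n x}) := by ext; simp [K]
    rw [this]
    exact isClosed_iInter fun n => (isClosed_le (hcont _ (hf n)) continuous_const).union
      (isClosed_le continuous_const (hcont _ (hf n)))
  have : CompactSpace K := isCompact_iff_compactSpace.1 hK.isCompact
  let φ : K → ℕ → Bool := fun x n => decide (b ≤ f n x)
  have hφ : Continuous φ := by
    refine continuous_pi fun n => (continuous_bool_rng true).2 ⟨?_, ?_⟩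
    · have : (fun x : K => φ x n) ⁻¹' {true} = {x : K | b ≤ f n x} := by ext; simp [φ]
      rw [this]
      exact isClosed_le continuous_const ((hcont _ (hf n)).comp continuous_subtype_val)
    · have : (fun x : K => φ x n) ⁻¹' {true} = {x : K | f n x ≤ a}ᶜ := by
        ext x
        have := x.2 n
        simp only [φ, Set.mem_preimage, Set.mem_singleton_iff, decide_eq_true_eq,
          Set.mem_compl_iff, Set.mem_ofPred_eq, not_le]
        exact ⟨fun h => hab.trans_le h, fun h => this.resolve_left h.not_ge⟩
      rw [this]
      exact (isClosed_le ((hcont _ (hf n)).comp continuous_subtype_val)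
        continuous_const).isOpen_compl
  have hsurj : Function.Surjective φ := by
    intro y
    have hne : (Set.univ ∩ ⋂ n, (if y n then {x | b ≤ f n x} else {x | f n x ≤ a})).Nonempty := by
      refine isCompact_univ.inter_iInter_nonempty _ (fun n => ?_) fun u => ?_
      · split_ifs
        · exact isClosed_le continuous_const (hcont _ (hf n))
        · exact isClosed_le (hcont _ (hf n)) continuous_const
      · obtain ⟨x, hx1, hx2⟩ := hind {n ∈ u | y n = false} {n ∈ u | y n = true} (by
          rw [Finset.disjoint_filter]; simp)
        refine ⟨x, trivial, Set.mem_iInter₂.2 fun n hn => ?_⟩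
        simp only [Set.mem_iInter, Finset.mem_filter, Set.mem_ofPred_eq, and_imp] at hx1 hx2
        cases h : y n
        · simpa using (hx1 n hn h).le
        · simpa using (hx2 n hn h).le
    obtain ⟨x, -, hx⟩ := hne
    rw [Set.mem_iInter] at hx
    have hx' : ∀ n, (y n = true → b ≤ f n x) ∧ (y n = false → f n x ≤ a) := fun n => by
      have := hx n
      cases h : y n <;> simpa [h] using this
    refine ⟨⟨x, fun n => ?_⟩, funext fun n => ?_⟩
    · cases h : y n
      · exact Or.inl ((hx' n).2 h)
      · exact Or.inr ((hx' n).1 h)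
    · cases h : y n
      · simpa [φ] using ((hx' n).2 h).trans_lt hab
      · simpa [φ] using (hx' n).1 h
  obtain ⟨E, hEc, hEs, hEmin⟩ := exists_isCompact_minimal_surjective hφ hsurj
  have hE : (Subtype.val '' E).Nonempty := by
    obtain ⟨e, he, -⟩ : (fun _ => true) ∈ φ '' E := hEs ▸ Set.mem_univ _
    exact ⟨_, e, he, rfl⟩
  obtain ⟨O, hO, ⟨z, hzE, hzO⟩, hdiam⟩ :=
    hfrag (b - a) (sub_pos.2 hab) _ hE.closure isClosed_closure
  let E₀ : Set E := {e | (e : K).1 ∉ O}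
  have hE₀ : IsClosed E₀ := (hO.preimage
    (continuous_subtype_val.comp continuous_subtype_val)).isClosed_compl
  have hE₀u : E₀ ≠ Set.univ := by
    obtain ⟨_, hO', e, he, rfl⟩ := mem_closure_iff.1 hzE O hO hzO
    exact fun h => (h ▸ Set.mem_univ (⟨e, he⟩ : E) : (⟨e, he⟩ : E) ∈ E₀) hO'
  obtain ⟨y, hy⟩ := (Set.ne_univ_iff_exists_notMem _).1 (hEmin E₀ hE₀u hE₀)
  have hcl : IsClosed (E.domRestrict φ '' E₀) :=
    (hE₀.isCompact.image hφ.continuousOn.domRestrict).isClosed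
  obtain ⟨I, u, hu, hsub⟩ := isOpen_pi_iff.1 hcl.isOpen_compl y hy
  have hpt : ∀ v : Bool, ∃ e : K, e.1 ∈ closure (Subtype.val '' E) ∩ O ∧ ∀ n ∉ I, φ e n = v := by
    intro v
    let w : ℕ → Bool := fun n => if n ∈ I then y n else v
    obtain ⟨e, he, hew⟩ : w ∈ φ '' E := hEs ▸ Set.mem_univ _
    refine ⟨e, ⟨subset_closure ⟨e, he, rfl⟩, ?_⟩, fun n hn => by rw [hew]; simp [w, hn]⟩
    by_contra heO
    refine hsub (a := w) (fun n hn => ?_) ⟨⟨e, he⟩, heO, hew⟩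
    have hn' : n ∈ I := hn
    simpa [w, hn'] using (hu n hn').2
  have hI : ∀ᶠ n in (hyperfilter ℕ : Filter ℕ), n ∉ I :=
    compl_mem_hyperfilter_of_finite I.finite_toSet
  obtain ⟨e₁, he₁, h₁⟩ := hpt true
  obtain ⟨e₀, he₀, h₀⟩ := hpt false
  have hg₁ : b ≤ g e₁ := ge_of_tendsto (hlim e₁) (hI.mono fun n hn => by
    simpa [φ] using h₁ n hn)
  have hg₀ : g e₀ ≤ a := le_of_tendsto (hlim e₀) (hI.mono fun n hn =>
    (e₀.2 n).resolve_right (by simpa [φ] using h₀ n hn))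
  have := (abs_lt.1 (hdiam _ he₁ _ he₀)).2
  linarith

theorem IsIndepSeq.isL1Seq {X : Type*} {f : ℕ → X → ℝ} {C : ℝ} (hC : ∀ n x, |f n x| ≤ C)
    (hf : IsIndepSeq f) : IsL1Seq f := by
  classical
  obtain ⟨a, b, hab, hind⟩ := hf
  refine ⟨(b - a) / 2, by linarith, fun n c => ?_⟩
  have hbdd : BddAbove (Set.range fun x => |∑ i, c i * f i x|) := by
    refine ⟨∑ i, |c i| * C, ?_⟩
    rintro _ ⟨x, rfl⟩
    refine (Finset.abs_sum_le_sum_abs _ _).trans (Finset.sum_le_sum fun i _ => ?_)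
    rw [abs_mul]
    exact mul_le_mul_of_nonneg_left (hC _ _) (abs_nonneg _)
  let P : Finset ℕ := (Finset.univ.filter fun i : Fin n => 0 ≤ c i).map Fin.valEmbedding
  let M : Finset ℕ := (Finset.univ.filter fun i : Fin n => ¬ 0 ≤ c i).map Fin.valEmbedding
  have hPM : Disjoint P M := by
    rw [Finset.disjoint_map]
    exact Finset.disjoint_filter_filter_not _ _ _
  obtain ⟨x, hx1, hx2⟩ := hind P M hPM
  obtain ⟨y, hy1, hy2⟩ := hind M P hPM.symm
  simp only [Set.mem_iInter, Set.mem_ofPred_eq] at hx1 hx2 hy1 hy2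
  have hle : (b - a) * ∑ i, |c i| ≤ ∑ i, c i * f i y - ∑ i, c i * f i x := by
    rw [← Finset.sum_sub_distrib, Finset.mul_sum]
    refine Finset.sum_le_sum fun i _ => ?_
    by_cases hi : 0 ≤ c i
    · have hP : (i : ℕ) ∈ P := Finset.mem_map.2 ⟨i, by simpa using hi, rfl⟩
      rw [abs_of_nonneg hi]
      nlinarith [hx1 i hP, hy2 i hP]
    · have hM : (i : ℕ) ∈ M := Finset.mem_map.2 ⟨i, by simpa using hi, rfl⟩
      rw [abs_of_neg (not_le.1 hi)]
      nlinarith [hx2 i hM, hy1 i hM]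
  have h1 := (le_abs_self _).trans (le_ciSup hbdd y)
  have h2 := (neg_le_abs _).trans (le_ciSup hbdd x)
  linarith

/-- For weights on the edges of a complete graph on `n` vertices, some two-colouring
makes the weight of the cut at least half of the total weight. -/
theorem exists_sign_sum_nonpos (t : ℕ → ℕ → ℝ) (n : ℕ) :
    ∃ ε : ℕ → ℝ, (∀ i, ε i = 1 ∨ ε i = -1) ∧
      ∑ j ∈ Finset.range n, ∑ i ∈ Finset.range j, t i j * (ε i * ε j) ≤ 0 := by
  induction n with
  | zero => exact ⟨fun _ => 1, by simp, by simp⟩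
  | succ n ih =>
    obtain ⟨ε, hε, hsum⟩ := ih
    obtain ⟨v, hv, hvs⟩ : ∃ v : ℝ, (v = 1 ∨ v = -1) ∧
        (∑ i ∈ Finset.range n, t i n * ε i) * v ≤ 0 := by
      rcases le_total (∑ i ∈ Finset.range n, t i n * ε i) 0 with h | h
      · exact ⟨1, Or.inl rfl, by simpa using h⟩
      · exact ⟨-1, Or.inr rfl, by simpa using h⟩
    refine ⟨Function.update ε n v, fun i => ?_, ?_⟩
    · rcases eq_or_ne i n with rfl | h
      · simpa using hv
      · simpa [h] using hε i
    · rw [Finset.sum_range_succ]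
      refine add_nonpos (le_of_eq_of_le (Finset.sum_congr rfl fun j hj =>
        Finset.sum_congr rfl fun i hi => ?_) hsum) (le_of_eq_of_le ?_ hvs)
      · have hj := Finset.mem_range.1 hj
        have hi := Finset.mem_range.1 hi
        rw [Function.update_of_ne (by omega), Function.update_of_ne (by omega)]
      · rw [Finset.sum_mul]
        refine Finset.sum_congr rfl fun i hi => ?_
        have hi := Finset.mem_range.1 hi
        rw [Function.update_of_ne (by omega), Function.update_self, mul_assoc]

theorem exists_coeff_le_weighted_sum_abs_sub {t : ℕ → ℕ → ℝ} (ht : ∀ i j, 0 ≤ t i j) {n : ℕ}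
    (hsum : ∑ j ∈ Finset.range n, ∑ i ∈ Finset.range j, t i j = 1) :
    ∃ c : Fin n → ℝ, 1 ≤ ∑ i, |c i| ∧ ∀ g : ℕ → ℝ, |∑ i, c i * g i| ≤
      ∑ j ∈ Finset.range n, ∑ i ∈ Finset.range j, t i j * |g i - g j| := by
  obtain ⟨ε, hε, hle⟩ := exists_sign_sum_nonpos t n
  let d : ℕ → ℝ := fun k => ∑ j ∈ Finset.range n, ∑ i ∈ Finset.range j,
    t i j * ((ε i - ε j) / 2) * ((if k = i then 1 else 0) - if k = j then 1 else 0)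
  have hd : ∀ g : ℕ → ℝ, ∑ k : Fin n, d k * g k =
      ∑ j ∈ Finset.range n, ∑ i ∈ Finset.range j, t i j * ((ε i - ε j) / 2) * (g i - g j) := by
    intro g
    rw [Fin.sum_univ_eq_sum_range (fun k => d k * g k) n]
    simp only [d, Finset.sum_mul]
    rw [Finset.sum_comm]
    refine Finset.sum_congr rfl fun j hj => ?_
    rw [Finset.sum_comm]
    refine Finset.sum_congr rfl fun i hi => ?_
    have hin : i ∈ Finset.range n :=
      Finset.mem_range.2 ((Finset.mem_range.1 hi).trans (Finset.mem_range.1 hj))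
    simp only [mul_assoc, ← Finset.mul_sum, sub_mul, ite_mul, one_mul, zero_mul,
      Finset.sum_sub_distrib, Finset.sum_ite_eq', hin, hj, if_true]
  refine ⟨fun k => d k, ?_, fun g => ?_⟩
  · have h1 : ∑ k : Fin n, d k * ε k = 1 -
        ∑ j ∈ Finset.range n, ∑ i ∈ Finset.range j, t i j * (ε i * ε j) := by
      rw [hd, ← hsum]
      simp only [← Finset.sum_sub_distrib]
      refine Finset.sum_congr rfl fun j _ => Finset.sum_congr rfl fun i _ => ?_
      rcases hε i with h | h <;> rcases hε j with h' | h' <;> rw [h, h'] <;> ring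
    have h2 : ∑ k : Fin n, d k * ε k ≤ ∑ k : Fin n, |d k| := by
      refine Finset.sum_le_sum fun k _ => (le_abs_self _).trans_eq ?_
      rcases hε k with h | h <;> simp [h]
    linarith
  · rw [hd]
    refine (Finset.abs_sum_le_sum_abs _ _).trans (Finset.sum_le_sum fun j _ =>
      (Finset.abs_sum_le_sum_abs _ _).trans (Finset.sum_le_sum fun i _ => ?_))
    rw [abs_mul, abs_mul, abs_of_nonneg (ht i j)]
    refine mul_le_mul_of_nonneg_right (mul_le_of_le_one_right (ht i j) ?_) (abs_nonneg _)
    rcases hε i with h | h <;> rcases hε j with h' | h' <;> rw [h, h'] <;> norm_num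

/-- A convex set of continuous functions, none of which is bounded above by a constant `< a`, is
bounded below in mean by a positive constant with respect to some finite measure. -/
theorem exists_measure_le_integral_of_convex {Y : Type*} [TopologicalSpace Y] [CompactSpace Y]
    [T2Space Y] [MeasurableSpace Y] [BorelSpace Y] {S : Set C(Y, ℝ)} (hS : Convex ℝ S) {a : ℝ}
    (ha : 0 < a) (h : ∀ s ∈ S, ∀ r < a, ∃ y, r < s y) :
    ∃ (μ : Measure Y) (_ : IsFiniteMeasure μ) (u : ℝ), 0 < u ∧ ∀ s ∈ S, u ≤ ∫ y, s y ∂μ := by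
  let T : Set C(Y, ℝ) := {h | ∃ r < a, ∀ y, h y ≤ r}
  have hTc : Convex ℝ T := by
    rintro f ⟨r, hr, hf⟩ g ⟨r', hr', hg⟩ α β hα hβ hαβ
    refine ⟨max r r', max_lt hr hr', fun y => ?_⟩
    have h1 := mul_le_mul_of_nonneg_left ((hf y).trans (le_max_left r r')) hα
    have h2 := mul_le_mul_of_nonneg_left ((hg y).trans (le_max_right r r')) hβ
    have h3 : (α • f + β • g) y = α * f y + β * g y := rfl
    calc (α • f + β • g) y ≤ (α + β) * max r r' := by rw [h3]; linarith
      _ = max r r' := by rw [hαβ, one_mul]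
  have hTo : IsOpen T := by
    rw [Metric.isOpen_iff]
    rintro f ⟨r, hr, hf⟩
    refine ⟨(a - r) / 2, by linarith, fun g hg => ⟨(a + r) / 2, by linarith, fun y => ?_⟩⟩
    have h1 := (ContinuousMap.dist_apply_le_dist y).trans_lt (Metric.mem_ball.1 hg)
    rw [Real.dist_eq] at h1
    linarith [hf y, (abs_lt.1 h1).2]
  have hdisj : Disjoint T S := by
    rw [Set.disjoint_left]
    rintro f ⟨r, hr, hf⟩ hfS
    obtain ⟨y, hy⟩ := h f hfS r hr
    exact hy.not_ge (hf y)
  obtain ⟨L, u, hLT, hLS⟩ := geometric_hahn_banach_open hTc hTo hS hdisj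
  have hu : 0 < u := by simpa using hLT 0 ⟨0, ha, fun _ => le_rfl⟩
  have hLpos : ∀ f : C(Y, ℝ), 0 ≤ f → 0 ≤ L f := by
    intro f hf
    by_contra! hneg
    have h1 := hLT ((u / L f) • f) ⟨0, ha, fun y =>
      mul_nonpos_of_nonpos_of_nonneg (div_neg_of_pos_of_neg hu hneg).le (hf y)⟩
    rw [map_smul, smul_eq_mul, div_mul_cancel₀ _ hneg.ne] at h1
    exact lt_irrefl _ h1
  let Λ : CompactlySupportedContinuousMap Y ℝ →ₚ[ℝ] ℝ := PositiveLinearMap.mk₀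
    { toFun := fun f => L f.toContinuousMap
      map_add' := fun f g => map_add L f.toContinuousMap g.toContinuousMap
      map_smul' := fun c f => map_smul L c f.toContinuousMap } fun f hf => hLpos _ hf
  refine ⟨RealRMK.rieszMeasure Λ, inferInstance, u, hu, fun s hs => (hLS s hs).trans_eq ?_⟩
  exact (RealRMK.integral_rieszMeasure Λ (CompactlySupportedContinuousMap.continuousMapEquiv s)).symm

theorem IsL1Seq.exists_measure_le_integral_abs_sub {Y : Type*} [TopologicalSpace Y]
    [CompactSpace Y] [T2Space Y] [MeasurableSpace Y] [BorelSpace Y] {f : ℕ → Y → ℝ}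
    (hcont : ∀ n, Continuous (f n)) (hf : IsL1Seq f) :
    ∃ (μ : Measure Y) (_ : IsFiniteMeasure μ) (u : ℝ), 0 < u ∧
      ∀ i j, i < j → u ≤ ∫ y, |f i y - f j y| ∂μ := by
  obtain ⟨a, ha, hf⟩ := hf
  have : Nonempty Y := by
    by_contra hY
    rw [not_nonempty_iff] at hY
    have := hf 1 fun _ => 1
    simp at this
    linarith
  let v : ℕ → ℕ → C(Y, ℝ) := fun i j =>
    ⟨fun y => |f i y - f j y|, ((hcont i).sub (hcont j)).abs⟩
  let S : Set C(Y, ℝ) := {h | ∃ t : ℕ → ℕ → ℝ, (∀ i j, 0 ≤ t i j) ∧ ∃ N, ∀ n ≥ N,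
    ∑ j ∈ Finset.range n, ∑ i ∈ Finset.range j, t i j = 1 ∧
    h = ∑ j ∈ Finset.range n, ∑ i ∈ Finset.range j, t i j • v i j}
  have hS : Convex ℝ S := by
    rintro g ⟨t, ht, N, hN⟩ g' ⟨t', ht', N', hN'⟩ α β hα hβ hαβ
    refine ⟨fun i j => α * t i j + β * t' i j, fun i j =>
      add_nonneg (mul_nonneg hα (ht i j)) (mul_nonneg hβ (ht' i j)), max N N', fun n hn => ?_⟩
    obtain ⟨h1, h2⟩ := hN n ((le_max_left _ _).trans hn)
    obtain ⟨h1', h2'⟩ := hN' n ((le_max_right _ _).trans hn)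
    constructor
    · simp only [Finset.sum_add_distrib, ← Finset.mul_sum, h1, h1', mul_one, hαβ]
    · rw [h2, h2']
      simp only [add_smul, mul_smul, Finset.sum_add_distrib, ← Finset.smul_sum]
  obtain ⟨μ, hμ, u, hu, hμu⟩ := exists_measure_le_integral_of_convex hS ha (by
    rintro s ⟨t, ht, N, hN⟩ r hr
    by_contra! hcon
    obtain ⟨h1, h2⟩ := hN N le_rfl
    obtain ⟨c, hc1, hc⟩ := exists_coeff_le_weighted_sum_abs_sub ht h1
    have h3 : ⨆ y, |∑ i, c i * f i y| ≤ r := ciSup_le fun y => by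
      refine (hc fun i => f i y).trans (le_trans (le_of_eq ?_) (hcon y))
      rw [h2]
      simp [v]
    have h4 := hf N c
    nlinarith)
  refine ⟨μ, hμ, u, hu, fun i j hij => hμu (v i j) ⟨fun k l => if k = i ∧ l = j then 1 else 0,
    fun k l => by beta_reduce; split_ifs <;> norm_num, j + 1, fun n hn => ?_⟩⟩
  have hj : j ∈ Finset.range n := Finset.mem_range.2 hn
  have hi : i ∈ Finset.range j := Finset.mem_range.2 hij
  constructor
  · rw [Finset.sum_eq_single_of_mem j hj fun l _ hl => by simp [hl],
      Finset.sum_eq_single_of_mem i hi fun k _ hk => by simp [hk]]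
    simp
  · rw [Finset.sum_eq_single_of_mem j hj fun l _ hl => by simp [hl],
      Finset.sum_eq_single_of_mem i hi fun k _ hk => by simp [hk]]
    simp

/-- If every measurable set of positive measure contains a measurable set of positive measure
satisfying `p`, then countably many sets satisfying `p` cover almost everything. -/
theorem exists_seq_measure_compl_iUnion_eq_zero {Y : Type*} [MeasurableSpace Y] {μ : Measure Y}
    [IsFiniteMeasure μ] {p : Set Y → Prop} (hp0 : p ∅)
    (hp : ∀ E, MeasurableSet E → 0 < μ E → ∃ V ⊆ E, MeasurableSet V ∧ 0 < μ V ∧ p V) :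
    ∃ V : ℕ → Set Y, (∀ k, MeasurableSet (V k) ∧ p (V k)) ∧ μ (⋃ k, V k)ᶜ = 0 := by
  let A : Set ENNReal :=
    {m | ∃ V : ℕ → Set Y, (∀ k, MeasurableSet (V k) ∧ p (V k)) ∧ μ (⋃ k, V k) = m}
  have hA : A.Nonempty := ⟨_, fun _ => ∅, fun _ => ⟨MeasurableSet.empty, hp0⟩, rfl⟩
  obtain ⟨u, -, hu, huA⟩ := exists_seq_tendsto_sSup hA (OrderTop.bddAbove A)
  choose V hV hVu using huA
  have hWmem : ∀ W : ℕ → Set Y, (∀ k, MeasurableSet (W k) ∧ p (W k)) →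
      μ (⋃ k, W k) ≤ sSup A := fun W hW => le_sSup ⟨W, hW, rfl⟩
  let e := (Nat.pairEquiv).symm
  let W : ℕ → Set Y := fun k => V (e k).1 (e k).2
  have hW : ∀ k, MeasurableSet (W k) ∧ p (W k) := fun k => hV _ _
  have hVW : ∀ n, ⋃ k, V n k ⊆ ⋃ k, W k := fun n => Set.iUnion_subset fun k =>
    Set.subset_iUnion_of_subset (e.symm (n, k)) (by simp [W])
  have hsup : sSup A ≤ μ (⋃ k, W k) :=
    le_of_tendsto' hu fun n => (hVu n).symm.le.trans (measure_mono (hVW n))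
  refine ⟨W, hW, ?_⟩
  by_contra hne
  have hWm : MeasurableSet (⋃ k, W k) := MeasurableSet.iUnion fun k => (hW k).1
  obtain ⟨D, hDW, hD, hDpos, hpD⟩ := hp _ hWm.compl (pos_iff_ne_zero.2 hne)
  let W' : ℕ → Set Y := fun k => Nat.casesOn k D W
  have hW' : ∀ k, MeasurableSet (W' k) ∧ p (W' k) := fun k => by
    cases k with
    | zero => exact ⟨hD, hpD⟩
    | succ k => exact hW k
  have hsub : (⋃ k, W k) ∪ D ⊆ ⋃ k, W' k := Set.union_subset
    (Set.iUnion_subset fun k => Set.subset_iUnion W' (k + 1)) (Set.subset_iUnion W' 0)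
  have hle := (measure_mono hsub).trans (hWmem W' hW')
  rw [measure_union (Set.subset_compl_iff_disjoint_left.1 hDW) hD] at hle
  exact (ENNReal.lt_add_right (measure_ne_top μ _) hDpos.ne').not_ge (hle.trans hsup)

theorem exists_integral_abs_sub_lt {Y : Type*} [TopologicalSpace Y] [MeasurableSpace Y]
    [OpensMeasurableSpace Y] {μ : Measure Y} [IsFiniteMeasure μ] {f : ℕ → Y → ℝ}
    (hcont : ∀ n, Continuous (f n)) {C : ℝ} (hC : ∀ n y, |f n y| ≤ C)
    (hind : ¬ ∃ g : ℕ → Y → ℝ, (∀ n, g n ∈ Set.range f) ∧ IsIndepSeq g) {u : ℝ} (hu : 0 < u) :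
    ∃ i j, i < j ∧ ∫ y, |f i y - f j y| ∂μ < u := by
  let m := μ.real Set.univ
  have hm : 0 ≤ m := measureReal_nonneg
  let δ := u / (2 * (m + 1))
  have hδ : 0 < δ := by positivity
  obtain ⟨V, hV, hVc⟩ := exists_seq_measure_compl_iUnion_eq_zero (μ := μ)
    (p := fun V => ∃ a b : ℝ, b - a < δ ∧ ∀ᶠ n in (hyperfilter ℕ : Filter ℕ),
      μ (V ∩ {y | f n y < a}) = 0 ∧ μ (V ∩ {y | b < f n y}) = 0)
    ⟨0, 0, by simpa using hδ, by simp⟩ (fun E hE hEpos => by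
      obtain ⟨E', ⟨V, hVm, hVE, hVpos⟩, hE'E, a, b, hab, hev⟩ :=
        exists_subset_small_oscillation (F := Set.range f) (U := (hyperfilter ℕ).map f) (C := C)
          (Ultrafilter.mem_map.2 (Filter.univ_mem' fun n => ⟨n, rfl⟩)) (by rintro _ ⟨n, rfl⟩; exact hC n) hind
          (G := {E | ∃ V, MeasurableSet V ∧ V ⊆ E ∧ 0 < μ V})
          (fun E ⟨V, _, hVE, hV⟩ => (nonempty_of_measure_ne_zero hV.ne').mono hVE)
          (fun E ⟨V, hVm, hVE, hV⟩ E' hE => ⟨V, hVm, hVE.trans hE, hV⟩)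
          (E := E) ⟨E, hE, subset_rfl, hEpos⟩ hδ
      refine ⟨V, hVE.trans hE'E, hVm, hVpos, a, b, hab, ?_⟩
      have hev' : ∀ᶠ n in (hyperfilter ℕ : Filter ℕ),
        E' ∩ {x | f n x < a} ∉ {E | ∃ V, MeasurableSet V ∧ V ⊆ E ∧ 0 < μ V} ∧
        E' ∩ {x | b < f n x} ∉ {E | ∃ V, MeasurableSet V ∧ V ⊆ E ∧ 0 < μ V} := hev
      filter_upwards [hev'] with n hn
      constructor
      · by_contra h0
        exact hn.1 ⟨_, hVm.inter (isOpen_lt (hcont n) continuous_const).measurableSet,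
          Set.inter_subset_inter_left _ hVE, pos_iff_ne_zero.2 h0⟩
      · by_contra h0
        exact hn.2 ⟨_, hVm.inter (isOpen_lt continuous_const (hcont n)).measurableSet,
          Set.inter_subset_inter_left _ hVE, pos_iff_ne_zero.2 h0⟩)
  choose hVm a b hab hev using hV
  have hWm : ∀ N, MeasurableSet (Set.accumulate V N) := fun N =>
    MeasurableSet.biUnion (Set.to_countable _) fun k _ => hVm k
  have hlim : Tendsto (fun N => μ.real (Set.accumulate V N)ᶜ) atTop (𝓝 0) := by
    have h1 := tendsto_measure_iInter_atTop (μ := μ) (s := fun N => (Set.accumulate V N)ᶜ)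
      (fun N => (hWm N).compl.nullMeasurableSet)
      (fun i j hij => Set.compl_subset_compl.2 (Set.monotone_accumulate hij))
      ⟨0, measure_ne_top _ _⟩
    rw [← Set.compl_iUnion, Set.iUnion_accumulate, hVc] at h1
    exact (ENNReal.tendsto_toReal ENNReal.zero_ne_top).comp h1
  obtain ⟨N, hN⟩ := (hlim.eventually_lt_const
    (show 0 < u / (4 * (|C| + 1)) by positivity)).exists
  let W := Set.accumulate V N
  have hall := (eventually_all_finite (Set.finite_Iic N)).2 fun k _ => hev k
  obtain ⟨i, hi⟩ := hall.exists
  obtain ⟨j, hj, hij⟩ := (hall.and (Nat.hyperfilter_le_atTop (Ioi_mem_atTop i))).exists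
  refine ⟨i, j, hij, ?_⟩
  have hae : ∀ᵐ y ∂μ, ∀ k ≤ N, y ∈ V k →
      (a k ≤ f i y ∧ f i y ≤ b k) ∧ (a k ≤ f j y ∧ f j y ≤ b k) := by
    refine ae_all_iff.2 fun k => eventually_imp_distrib_left.2 fun hk => ?_
    filter_upwards [measure_eq_zero_iff_ae_notMem.1 (hi k hk).1,
      measure_eq_zero_iff_ae_notMem.1 (hi k hk).2, measure_eq_zero_iff_ae_notMem.1 (hj k hk).1,
      measure_eq_zero_iff_ae_notMem.1 (hj k hk).2] with y h1 h2 h3 h4 hy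
    exact ⟨⟨not_lt.1 fun h => h1 ⟨hy, h⟩, not_lt.1 fun h => h2 ⟨hy, h⟩⟩,
      not_lt.1 fun h => h3 ⟨hy, h⟩, not_lt.1 fun h => h4 ⟨hy, h⟩⟩
  have hle2 : ∀ y, |f i y - f j y| ≤ 2 * |C| := fun y => by
    have h1 := (hC i y).trans (le_abs_self C)
    have h2 := (hC j y).trans (le_abs_self C)
    linarith [abs_sub (f i y) (f j y)]
  have hpt : ∀ᵐ y ∂μ, |f i y - f j y| ≤ δ + Wᶜ.indicator (fun _ => 2 * |C|) y := by
    filter_upwards [hae] with y hy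
    by_cases hyW : y ∈ W
    · obtain ⟨k, hk, hyk⟩ := Set.mem_accumulate.1 hyW
      obtain ⟨⟨h1, h2⟩, h3, h4⟩ := hy k hk hyk
      have := hab k
      rw [Set.indicator_of_notMem (by simpa using hyW), add_zero]
      exact abs_le.2 ⟨by linarith, by linarith⟩
    · rw [Set.indicator_of_mem (by simpa using hyW)]
      linarith [hle2 y]
  have hint : Integrable (fun y => |f i y - f j y|) μ :=
    Integrable.of_bound ((hcont i).sub (hcont j)).abs.measurable.aestronglyMeasurable (2 * |C|)
      (Eventually.of_forall fun y => by simpa using hle2 y)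
  have hind' : Integrable (Wᶜ.indicator fun _ => 2 * |C|) μ :=
    (integrable_const _).indicator (hWm N).compl
  calc ∫ y, |f i y - f j y| ∂μ
      ≤ ∫ y, (δ + Wᶜ.indicator (fun _ => 2 * |C|) y) ∂μ :=
        integral_mono_ae hint ((integrable_const _).add hind') hpt
    _ = m * δ + μ.real Wᶜ * (2 * |C|) := by
        rw [integral_add (integrable_const _) hind', integral_const,
          integral_indicator_const _ (hWm N).compl, smul_eq_mul, smul_eq_mul]
    _ < u := by
        have h1 : m * δ ≤ u / 2 := by
          have : (m + 1) * δ = u / 2 := by simp only [δ]; field_simp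
          nlinarith
        have h2 : μ.real Wᶜ * (2 * |C|) < u / 2 := by
          have h3 : u / (4 * (|C| + 1)) * (2 * (|C| + 1)) = u / 2 := by field_simp; norm_num
          have h4 : 0 ≤ |C| := abs_nonneg C
          have h5 : 0 ≤ μ.real Wᶜ := measureReal_nonneg
          have h6 : μ.real Wᶜ < u / (4 * (|C| + 1)) := hN
          nlinarith
        linarith

theorem IsL1Seq.exists_isIndepSeq {X : Type*} [TopologicalSpace X] [CompactSpace X]
    {f : ℕ → X → ℝ} (hcont : ∀ n, Continuous (f n)) {C : ℝ} (hC : ∀ n x, |f n x| ≤ C)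
    (hf : IsL1Seq f) : ∃ g : ℕ → X → ℝ, (∀ n, g n ∈ Set.range f) ∧ IsIndepSeq g := by
  -- Pass to the Hausdorff quotient of `X` separated by the sequence.
  let Φ : X → ℕ → ℝ := fun x n => f n x
  have hΦ : Continuous Φ := continuous_pi hcont
  let Y := Set.range Φ
  have : CompactSpace Y := isCompact_iff_compactSpace.1 (isCompact_range hΦ)
  let π : X → Y := Set.rangeFactorization Φ
  have hπ : Function.Surjective π := Set.rangeFactorization_surjective
  let F : ℕ → Y → ℝ := fun n y => y.1 n
  have hFcont : ∀ n, Continuous (F n) := fun n =>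
    (continuous_apply n).comp continuous_subtype_val
  have hFC : ∀ n y, |F n y| ≤ C := fun n y => by
    obtain ⟨x, rfl⟩ := hπ y
    exact hC n x
  have hFL1 : IsL1Seq F := by
    obtain ⟨a, ha, h⟩ := hf
    refine ⟨a, ha, fun n c => (h n c).trans_eq ?_⟩
    exact hπ.iSup_comp (fun y : Y => |∑ i, c i * F i y|)
  borelize ↥Y
  obtain ⟨μ, _, u, hu, hμ⟩ := hFL1.exists_measure_le_integral_abs_sub hFcont
  by_contra hind
  obtain ⟨i, j, hij, hlt⟩ := exists_integral_abs_sub_lt (μ := μ) hFcont hFC (by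
    rintro ⟨g, hg, a, b, hab, h⟩
    refine hind ⟨fun n x => g n (π x), fun n => ?_, a, b, hab, fun P M hPM => ?_⟩
    · obtain ⟨k, hk⟩ := hg n
      exact ⟨k, by beta_reduce; rw [← hk]; rfl⟩
    · obtain ⟨y, hy1, hy2⟩ := h P M hPM
      obtain ⟨x, rfl⟩ := hπ y
      refine ⟨x, ?_, ?_⟩
      · simpa using hy1
      · simpa using hy2) hu
  exact (hμ i j hij).not_gt hlt

/-- For a uniformly bounded family `F` of continuous real valued
functions on a compact space `X` the following are equivalent: (1) `F`
contains no independent sequence; (2) `F` contains no `ℓ¹`-sequence; (3)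
every function in the pointwise closure of `F` in `ℝ^X` is fragmented. -/
theorem tame_iff_no_l1_iff_rosenthal
    {X : Type*} [TopologicalSpace X] [CompactSpace X]
    (F : Set (X → ℝ))
    (hbd : ∃ C : ℝ, ∀ f ∈ F, ∀ x : X, |f x| ≤ C)
    (hcont : ∀ f ∈ F, Continuous f) :
    List.TFAE
      [¬ ∃ f : ℕ → X → ℝ, (∀ n, f n ∈ F) ∧ IsIndepSeq f,
       ¬ ∃ f : ℕ → X → ℝ, (∀ n, f n ∈ F) ∧ IsL1Seq f,
       ∀ g ∈ closure F, IsFragmentedReal g] := by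
  obtain ⟨C, hC⟩ := hbd
  tfae_have 1 → 3 := fun h g hg => isFragmentedReal_of_mem_closure hC hcont h hg
  tfae_have 3 → 1 := by
    rintro h ⟨f, hf, hind⟩
    obtain ⟨g, hg, hg'⟩ := exists_mem_closure_not_isFragmentedReal hC hcont hf hind
    exact hg' (h g hg)
  tfae_have 2 → 1 := fun h ⟨f, hf, hind⟩ => h ⟨f, hf, hind.isL1Seq fun n => hC _ (hf n)⟩
  tfae_have 1 → 2 := by
    rintro h ⟨f, hf, hL1⟩
    obtain ⟨g, hg, hind⟩ := hL1.exists_isIndepSeq (fun n => hcont _ (hf n)) fun n => hC _ (hf n)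
    refine h ⟨g, fun n => ?_, hind⟩
    obtain ⟨k, hk⟩ := hg n
    exact hk ▸ hf k
  tfae_finish
end

section
/- Let X be a compact Hausdorff space and S a monoid acting on X by continuous maps. Suppose there exists a uniformly bounded family F of continuous real-valued functions on X which separates the points of X, is S-invariant (if f ∈ F and s ∈ S then x ↦ f(sx) belongs to F), and contains no independent sequence. Then (S,X) is a tame system: every element p of the enveloping semigroup E(S,X) is a fragmented map p : X → X (with respect to the unique uniformity compatible with the compact topology of X). -/
/-- If every finite collection of good sets can be split simultaneously by a member of `G` at the
levels `a < b`, then `G` contains an independent sequence. -/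
theorem exists_isIndepSeq_of_forall_finite_split {X : Type*} {G : Set (X → ℝ)} {a b : ℝ}
    (hab : a < b) (good : Set X → Prop) (hne : ∀ U, good U → U.Nonempty)
    (hex : ∃ U, good U)
    (hsplit : ∀ T : Set (Set X), T.Finite → (∀ U ∈ T, good U) →
      ∃ g ∈ G, ∀ U ∈ T, good (U ∩ {x | g x < a}) ∧ good (U ∩ {x | b < g x})) :
    ∃ g : ℕ → X → ℝ, (∀ n, g n ∈ G) ∧ IsIndepSeq g := by
  obtain ⟨U₀, hU₀⟩ := hex
  let State := {T : Set (Set X) // T.Finite ∧ ∀ U ∈ T, good U}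
  have hchoice : ∀ T : State, ∃ g ∈ G, ∀ U ∈ T.1,
      good (U ∩ {x | g x < a}) ∧ good (U ∩ {x | b < g x}) :=
    fun T => hsplit T.1 T.2.1 T.2.2
  choose c hcG hc using hchoice
  let next : State → State := fun T =>
    ⟨(fun U => U ∩ {x | c T x < a}) '' T.1 ∪ (fun U => U ∩ {x | b < c T x}) '' T.1,
      (T.2.1.image _).union (T.2.1.image _), by
        rintro _ (⟨U, hU, rfl⟩ | ⟨U, hU, rfl⟩)
        · exact (hc T U hU).1
        · exact (hc T U hU).2⟩
  let T : ℕ → State := fun n =>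
    Nat.rec ⟨{U₀}, Set.finite_singleton _, by rintro _ rfl; exact hU₀⟩ (fun _ T => next T) n
  have key : ∀ (σ : ℕ → Prop) (n : ℕ), ∃ U ∈ (T n).1, ∀ x ∈ U, ∀ i < n,
      (σ i → c (T i) x < a) ∧ (¬ σ i → b < c (T i) x) := by
    intro σ n
    induction n with
    | zero => exact ⟨U₀, rfl, fun _ _ i hi => absurd hi (Nat.not_lt_zero i)⟩
    | succ n ih =>
      obtain ⟨U, hU, h⟩ := ih
      by_cases hσ : σ n
      · refine ⟨U ∩ {x | c (T n) x < a}, Or.inl ⟨U, hU, rfl⟩, fun x hx i hi => ?_⟩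
        rcases Nat.lt_succ_iff_lt_or_eq.mp hi with hi | rfl
        · exact h x hx.1 i hi
        · exact ⟨fun _ => hx.2, fun hn => absurd hσ hn⟩
      · refine ⟨U ∩ {x | b < c (T n) x}, Or.inr ⟨U, hU, rfl⟩, fun x hx i hi => ?_⟩
        rcases Nat.lt_succ_iff_lt_or_eq.mp hi with hi | rfl
        · exact h x hx.1 i hi
        · exact ⟨fun hn => absurd hn hσ, fun _ => hx.2⟩
  refine ⟨fun n => c (T n), fun n => hcG _, a, b, hab, fun P M hPM => ?_⟩
  obtain ⟨n, hn⟩ := (P ∪ M).exists_nat_subset_range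
  obtain ⟨U, hU, h⟩ := key (· ∈ P) n
  obtain ⟨x, hx⟩ := hne U ((T n).2.2 U hU)
  refine ⟨x, Set.mem_iInter₂.2 fun i hi => ?_, Set.mem_iInter₂.2 fun i hi => ?_⟩
  · exact (h x hx i (Finset.mem_range.1 (hn (Finset.mem_union_left _ hi)))).1 hi
  · exact (h x hx i (Finset.mem_range.1 (hn (Finset.mem_union_right _ hi)))).2
      fun hP => Finset.disjoint_left.1 hPM hP hi

/-- Finitely many upward closed properties, each avoidable below every good set, can be avoided
simultaneously. -/
theorem exists_subset_forall_not_of_finset {X ι : Type*} (good : Set X → Prop)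
    (Q : ι → Set X → Prop) (hQ : ∀ i U W, U ⊆ W → Q i U → Q i W)
    (h : ∀ i U, good U → ∃ W ⊆ U, good W ∧ ¬ Q i W) (I : Finset ι) (U : Set X) (hU : good U) :
    ∃ W ⊆ U, good W ∧ ∀ i ∈ I, ¬ Q i W := by
  classical
  induction I using Finset.induction_on with
  | empty => exact ⟨U, subset_rfl, hU, by simp⟩
  | insert i I _ ih =>
    obtain ⟨W, hWU, hW, hWI⟩ := ih
    obtain ⟨W', hW'W, hW', hi⟩ := h i W hW
    refine ⟨W', hW'W.trans hWU, hW', fun j hj => ?_⟩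
    rcases Finset.mem_insert.1 hj with rfl | hj
    · exact hi
    · exact fun hq => hWI j hj (hQ j _ _ hW'W hq)

/-- In a compact space with a point separating family `F` of continuous functions, pairs outside a
neighborhood of the diagonal are separated by finitely many functions and levels. -/
theorem exists_finset_separating_compl {X : Type*} [TopologicalSpace X] [CompactSpace X]
    {F : Set (X → ℝ)} (hFcont : ∀ f ∈ F, Continuous f)
    (hsep : ∀ x y : X, x ≠ y → ∃ f ∈ F, f x ≠ f y)
    {V : Set (X × X)} (hV : IsOpen V) (hdiag : ∀ x : X, (x, x) ∈ V) :
    ∃ I : Finset {t : (X → ℝ) × ℝ × ℝ // t.1 ∈ F ∧ t.2.1 < t.2.2}, ∀ x y, (x, y) ∉ V →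
      ∃ t ∈ I, (t.1.1 x < t.1.2.1 ∧ t.1.2.2 < t.1.1 y) ∨
        (t.1.1 y < t.1.2.1 ∧ t.1.2.2 < t.1.1 x) := by
  obtain ⟨I, hI⟩ := hV.isClosed_compl.isCompact.elim_finite_subcover
    (fun t : {t : (X → ℝ) × ℝ × ℝ // t.1 ∈ F ∧ t.2.1 < t.2.2} =>
      {z : X × X | t.1.1 z.1 < t.1.2.1 ∧ t.1.2.2 < t.1.1 z.2} ∪
        {z : X × X | t.1.1 z.2 < t.1.2.1 ∧ t.1.2.2 < t.1.1 z.1})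
    (fun t => by
      have h₁ := (hFcont _ t.2.1).comp (continuous_fst (X := X) (Y := X))
      have h₂ := (hFcont _ t.2.1).comp (continuous_snd (X := X) (Y := X))
      exact ((isOpen_lt h₁ continuous_const).inter (isOpen_lt continuous_const h₂)).union
        ((isOpen_lt h₂ continuous_const).inter (isOpen_lt continuous_const h₁)))
    (by
      rintro ⟨x, y⟩ hxy
      have hne : x ≠ y := by
        rintro rfl
        exact hxy (hdiag x)
      obtain ⟨f, hf, hfxy⟩ := hsep x y hne
      rcases lt_or_gt_of_ne hfxy with hlt | hlt
      · obtain ⟨a, ha, ha'⟩ := exists_between hlt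
        obtain ⟨b, hb, hb'⟩ := exists_between ha'
        exact Set.mem_iUnion.2 ⟨⟨(f, a, b), hf, hb⟩, Or.inl ⟨ha, hb'⟩⟩
      · obtain ⟨a, ha, ha'⟩ := exists_between hlt
        obtain ⟨b, hb, hb'⟩ := exists_between ha'
        exact Set.mem_iUnion.2 ⟨⟨(f, a, b), hf, hb⟩, Or.inr ⟨ha, hb'⟩⟩)
  refine ⟨I, fun x y hxy => ?_⟩
  obtain ⟨t, ht, h⟩ := Set.mem_iUnion₂.1 (hI (show (x, y) ∈ Vᶜ from hxy))
  exact ⟨t, ht, h⟩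

/-- If a compact Hausdorff `S`-system admits a uniformly bounded,
point separating, `S`-invariant tame family of continuous functions, then the
system is tame: every element `p` of the enveloping semigroup (the pointwise
closure of the translations in `X^X`) is a fragmented self-map of `X`.
Fragmentedness is stated with respect to the unique compatible uniformity of
the compact Hausdorff space `X`, whose entourages are exactly the supersets
of the open neighborhoods of the diagonal. -/
theorem tame_separating_family_implies_fragmented_enveloping_semigroup
    {X S : Type*} [TopologicalSpace X] [CompactSpace X] [T2Space X]
    [Monoid S] [MulAction S X]
    (hcont : ∀ s : S, Continuous (fun x : X => s • x))
    (F : Set (X → ℝ))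
    (hbd : ∃ C : ℝ, ∀ f ∈ F, ∀ x : X, |f x| ≤ C)
    (hFcont : ∀ f ∈ F, Continuous f)
    (hsep : ∀ x y : X, x ≠ y → ∃ f ∈ F, f x ≠ f y)
    (hinv : ∀ f ∈ F, ∀ s : S, (fun x : X => f (s • x)) ∈ F)
    (htame : ¬ ∃ g : ℕ → X → ℝ, (∀ n, g n ∈ F) ∧ IsIndepSeq g)
    (p : X → X)
    (hp : p ∈ closure {g : X → X | ∃ s : S, g = fun x => s • x}) :
    ∀ V : Set (X × X), IsOpen V → (∀ x : X, (x, x) ∈ V) →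
      ∀ A : Set X, A.Nonempty → IsClosed A →
        ∃ O : Set X, IsOpen O ∧ (A ∩ O).Nonempty ∧
          ∀ x ∈ A ∩ O, ∀ y ∈ A ∩ O, (p x, p y) ∈ V := by
  intro V hV hdiag A hA _
  by_contra! hcon
  obtain ⟨I, hI⟩ := exists_finset_separating_compl hFcont hsep hV hdiag
  let good : Set X → Prop := fun U => IsOpen U ∧ (A ∩ U).Nonempty
  let Q : {t : (X → ℝ) × ℝ × ℝ // t.1 ∈ F ∧ t.2.1 < t.2.2} → Set X → Prop := fun t U =>
    (∃ x ∈ A ∩ U, t.1.1 (p x) < t.1.2.1) ∧ ∃ y ∈ A ∩ U, t.1.2.2 < t.1.1 (p y)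
  have hQmono : ∀ t U W, U ⊆ W → Q t U → Q t W := by
    rintro t U W hUW ⟨⟨x, hx, hx'⟩, y, hy, hy'⟩
    exact ⟨⟨x, ⟨hx.1, hUW hx.2⟩, hx'⟩, y, ⟨hy.1, hUW hy.2⟩, hy'⟩
  have hosc : ∃ t O, good O ∧ ∀ W ⊆ O, good W → Q t W := by
    by_contra! hno
    obtain ⟨W, -, hW, hWI⟩ := exists_subset_forall_not_of_finset good Q hQmono hno I Set.univ
      ⟨isOpen_univ, by simpa using hA⟩
    obtain ⟨x, hx, y, hy, hxy⟩ := hcon W hW.1 hW.2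
    obtain ⟨t, ht, h | h⟩ := hI _ _ hxy
    · exact hWI t ht ⟨⟨x, hx, h.1⟩, y, hy, h.2⟩
    · exact hWI t ht ⟨⟨y, hy, h.1⟩, x, hx, h.2⟩
  obtain ⟨⟨⟨f, a, b⟩, hf, hab⟩, O, hO, hOQ⟩ := hosc
  refine htame (exists_isIndepSeq_of_forall_finite_split hab (fun U => good U ∧ U ⊆ O)
    (fun U hU => hU.1.2.mono Set.inter_subset_right) ⟨O, hO, subset_rfl⟩ fun T hT hgood => ?_)
  have hpts : ∀ U : T, (∃ x ∈ A ∩ U.1, f (p x) < a) ∧ ∃ y ∈ A ∩ U.1, b < f (p y) :=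
    fun U => hOQ U.1 (hgood U.1 U.2).2 (hgood U.1 U.2).1
  choose hlow hhigh using hpts
  choose x hx hxa using hlow
  choose y hy hyb using hhigh
  have : Finite T := hT
  have hopen : IsOpen (⋂ U : T, {q : X → X | f (q (x U)) < a} ∩ {q : X → X | b < f (q (y U))}) :=
    isOpen_iInter_of_finite fun U =>
      (isOpen_lt ((hFcont f hf).comp (continuous_apply (x U))) continuous_const).inter
        (isOpen_lt continuous_const ((hFcont f hf).comp (continuous_apply (y U))))
  obtain ⟨_, hq, s, rfl⟩ := mem_closure_iff.1 hp _ hopen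
    (Set.mem_iInter.2 fun U => ⟨hxa U, hyb U⟩)
  have hg : Continuous fun z : X => f (s • z) := (hFcont f hf).comp (hcont s)
  refine ⟨_, hinv f hf s, fun U hU => ?_⟩
  obtain ⟨⟨hUopen, -⟩, hUO⟩ := hgood U hU
  have hs := Set.mem_iInter.1 hq ⟨U, hU⟩
  exact ⟨⟨⟨hUopen.inter (isOpen_lt hg continuous_const),
      x ⟨U, hU⟩, (hx ⟨U, hU⟩).1, (hx ⟨U, hU⟩).2, hs.1⟩, Set.inter_subset_left.trans hUO⟩,
    ⟨⟨hUopen.inter (isOpen_lt continuous_const hg),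
      y ⟨U, hU⟩, (hy ⟨U, hU⟩).1, (hy ⟨U, hU⟩).2, hs.2⟩, Set.inter_subset_left.trans hUO⟩⟩
end
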